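/- arXiv:1711.05804 — 2 statements merged into one kernel-verified Lean document; each statement's English description precedes it below -/
import Mathlib

section
/- Let X ⊆ ℝ^n be a semialgebraic set and let U, V ⊆ ℝ^n be open semialgebraic sets such that X is closed in U and X is closed in V. Then {φ|_X : φ ∈ 𝓢(ℝ^n), φ flat on ℝ^n \ U} = {φ|_X : φ ∈ 𝓢(ℝ^n), φ flat on ℝ^n \ V}; that is, the space of Schwartz functions on X does not depend on the ambient open semialgebraic set in which X is closed. -/
/-- A set `S ⊆ ℝⁿ` is semialgebraic if it is a finite union of sets of the form
`{x | p(x) = 0, q₁(x) > 0, …, q_r(x) > 0}` for real polynomials. -/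
def IsSemialgebraic {n : ℕ} (S : Set (Fin n → ℝ)) : Prop :=
  ∃ (m : ℕ) (p : Fin m → MvPolynomial (Fin n) ℝ)
    (Q : Fin m → Finset (MvPolynomial (Fin n) ℝ)),
    S = ⋃ i, {x | MvPolynomial.eval x (p i) = 0 ∧ ∀ q ∈ Q i, 0 < MvPolynomial.eval x q}

/-- A smooth function is flat at `z` if all its iterated derivatives (including the
value, `k = 0`) vanish at `z`. -/
def SmoothFlatAt {n : ℕ} (φ : (Fin n → ℝ) → ℝ) (z : Fin n → ℝ) : Prop :=
  ∀ k : ℕ, iteratedFDeriv ℝ k φ z = 0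

/-- For `W ⊆ ℝⁿ` open semialgebraic and `V ⊆ W` closed in `W`, the space
`𝓢_W(V) := {φ|_V : φ ∈ 𝓢(ℝⁿ), φ flat on ℝⁿ \ W}`. -/
def SchwartzRelOpen {n : ℕ} (W V : Set (Fin n → ℝ)) : Set (↥V → ℝ) :=
  {f | ∃ φ : SchwartzMap ((Fin n) → ℝ) ℝ,
        (∀ z ∈ Wᶜ, SmoothFlatAt (⇑φ) z) ∧ ∀ v : ↥V, f v = φ v}

section
open Polynomial

namespace SemiAlg

/-- Predicates generated by positivity of functions in a given algebra. -/
inductive SA {X : Type} (A : Subalgebra ℝ (X → ℝ)) : (X → Prop) → Prop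
  | pos (f : X → ℝ) (hf : f ∈ A) : SA A (fun x => 0 < f x)
  | not (P : X → Prop) (h : SA A P) : SA A (fun x => ¬ P x)
  | and (P Q : X → Prop) (h : SA A P) (h' : SA A Q) : SA A (fun x => P x ∧ Q x)

section basic
variable {X Y : Type} {A : Subalgebra ℝ (X → ℝ)} {B : Subalgebra ℝ (Y → ℝ)} {P Q : X → Prop}

theorem SA.congr (h : SA A P) (e : ∀ x, P x ↔ Q x) : SA A Q := by
  have : P = Q := funext fun x => propext (e x)
  exact this ▸ h

theorem SA.neg' (h : SA A P) : SA A (fun x => ¬ P x) := SA.not _ h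

theorem SA.and' (h : SA A P) (h' : SA A Q) : SA A (fun x => P x ∧ Q x) := SA.and _ _ h h'

theorem SA.or' (h : SA A P) (h' : SA A Q) : SA A (fun x => P x ∨ Q x) :=
  ((h.neg'.and' h'.neg').neg').congr fun x => by tauto

theorem SA.imp' (h : SA A P) (h' : SA A Q) : SA A (fun x => P x → Q x) :=
  (h.neg'.or' h').congr fun x => by tauto

theorem SA.const (p : Prop) : SA A (fun _ => p) := by
  by_cases hp : p
  · exact (SA.pos (A := A) (1 : X → ℝ) (one_mem A)).congr fun x => by simp [hp]
  · exact (SA.pos (A := A) (0 : X → ℝ) (zero_mem A)).congr fun x => by simp [hp]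

theorem SA.lt' {f g : X → ℝ} (hf : f ∈ A) (hg : g ∈ A) : SA A (fun x => f x < g x) :=
  (SA.pos (g - f) (sub_mem hg hf)).congr fun x => by simp

theorem SA.le' {f g : X → ℝ} (hf : f ∈ A) (hg : g ∈ A) : SA A (fun x => f x ≤ g x) :=
  (SA.lt' hg hf).neg'.congr fun x => by simp

theorem SA.eq' {f g : X → ℝ} (hf : f ∈ A) (hg : g ∈ A) : SA A (fun x => f x = g x) :=
  ((SA.le' hf hg).and' (SA.le' hg hf)).congr fun x => by rw [le_antisymm_iff]

theorem SA.sign' {f : X → ℝ} (hf : f ∈ A) (s : SignType) :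
    SA A (fun x => SignType.sign (f x) = s) := by
  have h0 : (0 : X → ℝ) ∈ A := zero_mem A
  rcases s with _ | _ | _
  · exact (SA.eq' hf h0).congr fun x => by simp
  · exact (SA.lt' hf h0).congr fun x => by simpa using sign_eq_neg_one_iff.symm
  · exact (SA.lt' h0 hf).congr fun x => by simpa using sign_eq_one_iff.symm

theorem SA.existsFin {ι : Type*} [Finite ι] {P : ι → X → Prop} (h : ∀ i, SA A (P i)) :
    SA A (fun x => ∃ i, P i x) := by
  classical
  have := Fintype.ofFinite ι
  have key : ∀ s : Finset ι, SA A (fun x => ∃ i ∈ s, P i x) := by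
    intro s
    induction s using Finset.induction_on with
    | empty => exact (SA.const False).congr fun x => by simp
    | insert a s ha ih => exact ((h a).or' ih).congr fun x => by simp
  exact (key Finset.univ).congr fun x => by simp

theorem SA.forallFin {ι : Type*} [Finite ι] {P : ι → X → Prop} (h : ∀ i, SA A (P i)) :
    SA A (fun x => ∀ i, P i x) :=
  (SA.existsFin fun i => (h i).neg').neg'.congr fun x => by simp

theorem SA.pullback {P : X → Prop} (h : SA A P) (g : Y → X) (hg : ∀ f ∈ A, f ∘ g ∈ B) :
    SA B (fun y => P (g y)) := by
  induction h with
  | pos f hf => exact SA.pos (f ∘ g) (hg f hf)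
  | not P _ ih => exact ih.neg'
  | and P Q _ _ ih ih' => exact ih.and' ih'

theorem SA.sat {P : X → Prop} (h : SA A P) : ∃ (m : ℕ) (f : Fin m → X → ℝ), (∀ i, f i ∈ A) ∧
    ∀ y y', (∀ i, SignType.sign (f i y) = SignType.sign (f i y')) → (P y ↔ P y') := by
  induction h with
  | pos f hf =>
    refine ⟨1, fun _ => f, fun _ => hf, fun y y' h => ?_⟩
    have := h 0
    change 0 < f y ↔ 0 < f y'
    rw [← sign_eq_one_iff, ← sign_eq_one_iff, this]
  | not P _ ih =>
    obtain ⟨m, f, hf, h⟩ := ih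
    exact ⟨m, f, hf, fun y y' hy => not_congr (h y y' hy)⟩
  | and P Q _ _ ih ih' =>
    obtain ⟨m, f, hf, h⟩ := ih
    obtain ⟨m', f', hf', h'⟩ := ih'
    refine ⟨m + m', Fin.append f f', fun i => ?_, fun y y' hy => and_congr (h y y' ?_) (h' y y' ?_)⟩
    · refine Fin.addCases (fun i => ?_) (fun i => ?_) i
      · simpa using hf i
      · simpa using hf' i
    · intro i
      simpa using hy (Fin.castAdd m' i)
    · intro i
      simpa using hy (Fin.natAdd m i)

/-- Evaluation at a point. -/
noncomputable def ev (A : Subalgebra ℝ (X → ℝ)) (x : X) : A →+* ℝ :=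
  (Pi.evalRingHom (fun _ : X => ℝ) x).comp A.val.toRingHom

@[simp] theorem ev_apply (x : X) (f : A) : ev A x f = f.1 x := rfl

/-- Specialization of a polynomial at a parameter. -/
noncomputable def pe (p : Polynomial A) (x : X) : ℝ[X] := p.map (ev A x)

/-- The functions on `X × ℝ` which are polynomial in the last variable, coefficients in `A`. -/
noncomputable def ext (A : Subalgebra ℝ (X → ℝ)) : Subalgebra ℝ (X × ℝ → ℝ) where
  carrier := {F | ∃ p : Polynomial A, ∀ x t, F (x, t) = (pe p x).eval t}
  mul_mem' := by
    rintro F G ⟨p, hp⟩ ⟨q, hq⟩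
    exact ⟨p * q, fun x t => by simp [pe, hp, hq]⟩
  add_mem' := by
    rintro F G ⟨p, hp⟩ ⟨q, hq⟩
    exact ⟨p + q, fun x t => by simp [pe, hp, hq]⟩
  algebraMap_mem' := by
    intro r
    exact ⟨C (algebraMap ℝ A r), fun x t => by simp [pe]⟩

theorem mem_ext {F : X × ℝ → ℝ} : F ∈ ext A ↔ ∃ p : Polynomial A, ∀ x t, F (x, t) = (pe p x).eval t :=
  Iff.rfl

theorem eval_mem_ext (p : Polynomial A) : (fun y : X × ℝ => (pe p y.1).eval y.2) ∈ ext A :=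
  ⟨p, fun _ _ => rfl⟩

theorem fst_mem_ext {f : X → ℝ} (hf : f ∈ A) : (fun y : X × ℝ => f y.1) ∈ ext A :=
  ⟨C ⟨f, hf⟩, fun _ _ => by simp [pe]⟩

theorem snd_mem_ext : (fun y : X × ℝ => y.2) ∈ ext A :=
  ⟨Polynomial.X, fun _ _ => by simp [pe]⟩

theorem SA.fst {P : X → Prop} (h : SA A P) : SA (ext A) (fun y => P y.1) :=
  h.pullback Prod.fst fun _ hf => fst_mem_ext hf

/-- Substituting a function of the algebra for the last variable. -/
theorem ext_subst {F : X × ℝ → ℝ} (hF : F ∈ ext A) (g : Y → X) (hg : ∀ f ∈ A, f ∘ g ∈ B)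
    {u : Y → ℝ} (hu : u ∈ B) : (fun y => F (g y, u y)) ∈ B := by
  obtain ⟨p, hp⟩ := hF
  have : (fun y => F (g y, u y)) =
      ∑ i ∈ Finset.range (p.natDegree + 1), ((p.coeff i).1 ∘ g) * u ^ i := by
    funext y
    rw [hp, pe, eval_map, eval₂_eq_sum_range]
    simp
  rw [this]
  exact sum_mem fun i _ => mul_mem (hg _ (p.coeff i).2) (pow_mem hu i)

/-- Lift of coefficients to the algebra with one more variable. -/
noncomputable def lift (p : Polynomial A) : Polynomial (ext A) :=
  p.map ({ toFun := fun f => ⟨fun y => f.1 y.1, fst_mem_ext f.2⟩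
           map_one' := rfl
           map_mul' := fun _ _ => rfl
           map_zero' := rfl
           map_add' := fun _ _ => rfl } : A →+* ext A)

theorem pe_lift (p : Polynomial A) (y : X × ℝ) : pe (lift p) y = pe p y.1 := by
  rw [pe, lift, Polynomial.map_map]
  rfl

theorem natDegree_lift (p : Polynomial A) : (lift p).natDegree ≤ p.natDegree :=
  natDegree_map_le

/-- Roots of nonzero specializations of a finite family. -/
def Rt {ι : Type} (q : ι → Polynomial A) (x : X) : Set ℝ := {t | ∃ i, pe (q i) x ≠ 0 ∧ (pe (q i) x).IsRoot t}

end basic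

/-- Elimination of a quantifier over roots of a polynomial of degree at most `d`. -/
def Elim (d : ℕ) : Prop := ∀ (X : Type) (A : Subalgebra ℝ (X → ℝ)) (p : Polynomial A)
  (S : X × ℝ → Prop), p.natDegree ≤ d → SA (ext A) S →
    SA A (fun x => pe p x ≠ 0 ∧ ∃ t, (pe p x).IsRoot t ∧ S (x, t))

section elim
variable {X : Type} {A : Subalgebra ℝ (X → ℝ)}

theorem elimR {d : ℕ} (hd : Elim d) {ι : Type} [Finite ι] (q : ι → Polynomial A)
    (hq : ∀ i, (q i).natDegree ≤ d) {S : X × ℝ → Prop} (hS : SA (ext A) S) :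
    SA A (fun x => ∃ t ∈ Rt q x, S (x, t)) :=
  (SA.existsFin fun i => hd X A (q i) S (hq i) hS).congr fun x => by
    constructor
    · rintro ⟨i, h0, t, h1, h2⟩
      exact ⟨t, ⟨i, h0, h1⟩, h2⟩
    · rintro ⟨t, ⟨i, h0, h1⟩, h2⟩
      exact ⟨i, h0, t, h1, h2⟩

theorem Rt_lift {ι : Type} (q : ι → Polynomial A) (y : X × ℝ) :
    Rt (fun i => lift (q i)) y = Rt q y.1 := by
  simp [Rt, pe_lift]

theorem Rt_finite {ι : Type} [Finite ι] (q : ι → Polynomial A) (x : X) : (Rt q x).Finite := by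
  have : Rt q x = ⋃ i, {t | pe (q i) x ≠ 0 ∧ (pe (q i) x).IsRoot t} := by
    ext t; simp [Rt]
  rw [this]
  refine Set.finite_iUnion fun i => ?_
  by_cases h : pe (q i) x = 0
  · simp [h]
  · exact (Polynomial.finite_setOfPred_isRoot h).subset fun t ht => ht.2

theorem elimR2 {d : ℕ} (hd : Elim d) {ι : Type} [Finite ι] (q : ι → Polynomial A)
    (hq : ∀ i, (q i).natDegree ≤ d) {S : (X × ℝ) × ℝ → Prop} (hS : SA (ext (ext A)) S) :
    SA (ext A) (fun y => ∃ t ∈ Rt q y.1, S (y, t)) :=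
  (elimR hd (fun i => lift (q i)) (fun i => (natDegree_lift _).trans (hq i)) hS).congr fun y => by
    rw [Rt_lift]

/-- constancy of sign on intervals without roots -/
theorem sign_const {q : ℝ[X]} {a b : ℝ} (h : q = 0 ∨ ∀ t, a < t → t < b → ¬ q.IsRoot t) {s t : ℝ}
    (hs : a < s ∧ s < b) (ht : a < t ∧ t < b) :
    SignType.sign (q.eval s) = SignType.sign (q.eval t) := by
  rcases h with rfl | h
  · simp
  wlog hst : s ≤ t generalizing s t
  · exact (this ht hs (le_of_not_ge hst)).symm
  have hc : ContinuousOn (fun u => q.eval u) (Set.Icc s t) := q.continuous.continuousOn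
  have ns : q.eval s ≠ 0 := h s hs.1 hs.2
  have nt : q.eval t ≠ 0 := h t ht.1 ht.2
  rcases lt_or_gt_of_ne ns with h1 | h1 <;> rcases lt_or_gt_of_ne nt with h2 | h2
  · rw [sign_neg h1, sign_neg h2]
  · obtain ⟨u, hu, hu0⟩ := intermediate_value_Icc hst hc ⟨h1.le, h2.le⟩
    exact absurd hu0 (h u (hs.1.trans_le hu.1) (hu.2.trans_lt ht.2))
  · obtain ⟨u, hu, hu0⟩ := intermediate_value_Icc' hst hc ⟨h2.le, h1.le⟩
    exact absurd hu0 (h u (hs.1.trans_le hu.1) (hu.2.trans_lt ht.2))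
  · rw [sign_pos h1, sign_pos h2]

theorem mul_neg_of_deriv {p : ℝ[X]} {a b t : ℝ} (hat : a < t) (htb : t < b) (h0 : p.IsRoot t)
    (h : ∀ t, a < t → t < b → ¬ (derivative p).IsRoot t) : p.eval a * p.eval b < 0 := by
  have hc : ContinuousOn (fun u => p.eval u) (Set.Icc a b) := p.continuous.continuousOn
  have hab := hat.trans htb
  have ma : a ∈ Set.Icc a b := ⟨le_rfl, hab.le⟩
  have mb : b ∈ Set.Icc a b := ⟨hab.le, le_rfl⟩
  have mt : t ∈ Set.Icc a b := ⟨hat.le, htb.le⟩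
  have h0' : p.eval t = 0 := h0
  have hs : ∀ u ∈ Set.Ioo a b, SignType.sign ((derivative p).eval u) = SignType.sign ((derivative p).eval t) :=
    fun u hu => sign_const (Or.inr h) hu ⟨hat, htb⟩
  rcases lt_or_gt_of_ne (h t hat htb) with h1 | h1
  · have : StrictAntiOn (fun u => p.eval u) (Set.Icc a b) := by
      refine strictAntiOn_of_deriv_neg (convex_Icc a b) hc fun u hu => ?_
      rw [interior_Icc] at hu
      rw [Polynomial.deriv, ← sign_eq_neg_one_iff, hs u hu, sign_eq_neg_one_iff]
      exact h1
    have e1 : p.eval t < p.eval a := this ma mt hat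
    have e2 : p.eval b < p.eval t := this mt mb htb
    rw [h0'] at e1 e2
    exact mul_neg_of_pos_of_neg e1 e2
  · have : StrictMonoOn (fun u => p.eval u) (Set.Icc a b) := by
      refine strictMonoOn_of_deriv_pos (convex_Icc a b) hc fun u hu => ?_
      rw [interior_Icc] at hu
      rw [Polynomial.deriv, ← sign_eq_one_iff, hs u hu, sign_eq_one_iff]
      exact h1
    have e1 : p.eval a < p.eval t := this ma mt hat
    have e2 : p.eval t < p.eval b := this mt mb htb
    rw [h0'] at e1 e2
    exact mul_neg_of_neg_of_pos e1 e2

theorem exists_nearest_left {R : Set ℝ} (hR : R.Finite) {t : ℝ} (h : ∃ a ∈ R, a < t) :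
    ∃ a ∈ R, a < t ∧ ∀ c ∈ R, c < t → c ≤ a := by
  have hf : (R ∩ Set.Iio t).Finite := hR.subset Set.inter_subset_left
  obtain ⟨a0, h1, h2⟩ := h
  obtain ⟨a, ha, hm⟩ := Set.exists_max_image (R ∩ Set.Iio t) id hf ⟨a0, h1, h2⟩
  exact ⟨a, ha.1, ha.2, fun c hc hct => hm c ⟨hc, hct⟩⟩

theorem exists_nearest_right {R : Set ℝ} (hR : R.Finite) {t : ℝ} (h : ∃ a ∈ R, t < a) :
    ∃ a ∈ R, t < a ∧ ∀ c ∈ R, t < c → a ≤ c := by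
  have hf : (R ∩ Set.Ioi t).Finite := hR.subset Set.inter_subset_left
  obtain ⟨a0, h1, h2⟩ := h
  obtain ⟨a, ha, hm⟩ := Set.exists_min_image (R ∩ Set.Ioi t) id hf ⟨a0, h1, h2⟩
  exact ⟨a, ha.1, ha.2, fun c hc hct => hm c ⟨hc, hct⟩⟩

/-- The univariate core of the elimination step. -/
theorem core {p : ℝ[X]} {ι : Type} {L : ι → ℝ[X]} {R : Set ℝ} (hR : R.Finite)
    (hL : ∀ i, L i = 0 ∨ ∀ t, (L i).IsRoot t → t ∈ R)
    (hp : ∀ t, (derivative p).IsRoot t → t ∈ R)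
    (hb : ∀ t, p.IsRoot t → (∃ a ∈ R, a < t) ∧ (∃ b ∈ R, t < b)) {S : ℝ → Prop}
    (hS : ∀ t t', (∀ i, SignType.sign ((L i).eval t) = SignType.sign ((L i).eval t')) → (S t ↔ S t')) :
    (∃ t, p.IsRoot t ∧ S t) ↔ (∃ t ∈ R, p.IsRoot t ∧ S t) ∨
      ∃ a ∈ R, ∃ b ∈ R, (a < b ∧ p.eval a * p.eval b < 0) ∧ S ((a + b) / 2) ∧
        ¬ ∃ c ∈ R, a < c ∧ c < b := by
  have hsig : ∀ a b, (¬ ∃ c ∈ R, a < c ∧ c < b) → ∀ s t, (a < s ∧ s < b) → (a < t ∧ t < b) →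
      (S s ↔ S t) := by
    intro a b hn s t hs ht
    refine hS s t fun i => sign_const ?_ hs ht
    exact (hL i).imp id fun h u h1 h2 h3 => hn ⟨u, h u h3, h1, h2⟩
  constructor
  · rintro ⟨t, h0, hSt⟩
    by_cases htR : t ∈ R
    · exact Or.inl ⟨t, htR, h0, hSt⟩
    right
    obtain ⟨a, haR, hat, ha⟩ := exists_nearest_left hR (hb t h0).1
    obtain ⟨b, hbR, htb, hb'⟩ := exists_nearest_right hR (hb t h0).2
    have hn : ¬ ∃ c ∈ R, a < c ∧ c < b := by
      rintro ⟨c, hc, h1, h2⟩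
      rcases lt_trichotomy c t with h | h | h
      · exact absurd (ha c hc h) (not_le.2 h1)
      · exact htR (h ▸ hc)
      · exact absurd (hb' c hc h) (not_le.2 h2)
    refine ⟨a, haR, b, hbR, ⟨hat.trans htb, ?_⟩, ?_, hn⟩
    · exact mul_neg_of_deriv hat htb h0 fun u h1 h2 h3 => hn ⟨u, hp u h3, h1, h2⟩
    · exact (hsig a b hn t _ ⟨hat, htb⟩ ⟨by linarith, by linarith⟩).1 hSt
  · rintro (⟨t, _, h0, hSt⟩ | ⟨a, haR, b, hbR, ⟨hab, hneg⟩, hSm, hn⟩)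
    · exact ⟨t, h0, hSt⟩
    · have hc : ContinuousOn (fun u => p.eval u) (Set.Icc a b) := p.continuous.continuousOn
      obtain ⟨t, ht, ht0⟩ : ∃ t ∈ Set.Ioo a b, p.eval t = 0 := by
        rcases mul_neg_iff.1 hneg with ⟨h1, h2⟩ | ⟨h1, h2⟩
        · exact intermediate_value_Ioo' hab.le hc ⟨h2, h1⟩
        · exact intermediate_value_Ioo hab.le hc ⟨h1, h2⟩
      exact ⟨t, ht0, (hsig a b hn t _ ht ⟨by linarith, by linarith⟩).2 hSm⟩

end elim

end SemiAlg
end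

section
open Polynomial
namespace SemiAlg
section step
variable {X : Type} {A : Subalgebra ℝ (X → ℝ)}

theorem pseudo_div {R : Type*} [CommRing R] {e : ℕ} (p : R[X]) (hp : p.natDegree ≤ e + 1) (m : ℕ) :
    ∀ q : R[X], q.natDegree ≤ m → ∃ (k : ℕ) (r s : R[X]), r.natDegree ≤ e ∧
      C (p.coeff (e + 1) ^ k) * q = r + s * p := by
  induction m with
  | zero => exact fun q hq => ⟨0, q, 0, hq.trans (Nat.zero_le _), by simp⟩
  | succ m ih =>
    intro q hq
    by_cases hm : m + 1 ≤ e
    · exact ⟨0, q, 0, hq.trans hm, by simp⟩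
    set a := p.coeff (e + 1) with ha
    have hdeg : (C a * q - C (q.coeff (m + 1)) * (X ^ (m - e) * p)).natDegree ≤ m := by
      rw [natDegree_le_iff_coeff_eq_zero]
      intro N hN
      rw [coeff_sub, coeff_C_mul, coeff_C_mul, coeff_X_pow_mul']
      rw [if_pos (by omega)]
      rcases Nat.lt_or_ge (m + 1) N with h | h
      · rw [coeff_eq_zero_of_natDegree_lt (lt_of_le_of_lt hq h),
          coeff_eq_zero_of_natDegree_lt (lt_of_le_of_lt hp (by omega))]
        simp
      · have : N = m + 1 := by omega
        subst this
        have : m + 1 - (m - e) = e + 1 := by omega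
        rw [this, ← ha]
        ring
    obtain ⟨k, r, s, hr, h⟩ := ih _ hdeg
    refine ⟨k + 1, r, s + C (a ^ k) * (C (q.coeff (m + 1)) * X ^ (m - e)), hr, ?_⟩
    have e1 : C (a ^ (k + 1)) * q = C (a ^ k) * (C a * q - C (q.coeff (m + 1)) * (X ^ (m - e) * p))
        + C (a ^ k) * (C (q.coeff (m + 1)) * X ^ (m - e)) * p := by
      rw [pow_succ, C_mul]; ring
    rw [e1, h]; ring

theorem reduceS {e : ℕ} (p : Polynomial A) (hp : p.natDegree ≤ e + 1) {S : X × ℝ → Prop}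
    (hS : SA (ext A) S) : ∃ (m : ℕ) (r : Fin m → Polynomial A) (S' : X × ℝ → Prop),
      (∀ i, (r i).natDegree ≤ e) ∧ SA (ext A) S' ∧
      (∀ y y' : X × ℝ, (∀ i, SignType.sign ((pe (r i) y.1).eval y.2) =
        SignType.sign ((pe (r i) y'.1).eval y'.2)) → (S' y ↔ S' y')) ∧
      ∀ x t, (p.coeff (e + 1)).1 x ≠ 0 → (pe p x).IsRoot t → (S (x, t) ↔ S' (x, t)) := by
  obtain ⟨m, f, hf, hsat⟩ := hS.sat
  choose q hq using hf
  choose k r s hr hrs using fun i => pseudo_div p hp _ (q i) le_rfl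
  set a := p.coeff (e + 1) with ha
  refine ⟨m, fun i => C (a ^ k i) * r i, fun y => ∃ σ : Fin m → SignType,
    (∃ y0, S y0 ∧ ∀ i, SignType.sign (f i y0) = σ i) ∧
      ∀ i, SignType.sign ((pe (C (a ^ k i) * r i) y.1).eval y.2) = σ i,
    fun i => (natDegree_C_mul_le _ _).trans (hr i), ?_, ?_, ?_⟩
  · exact SA.existsFin fun σ => (SA.const _).and' (SA.forallFin fun i => SA.sign' (eval_mem_ext _) _)
  · intro y y' h
    simp only [h]
  · intro x t hax ht
    have hsg : ∀ i, SignType.sign ((pe (C (a ^ k i) * r i) x).eval t) = SignType.sign (f i (x, t)) := by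
      intro i
      have h1 : (pe (C (a ^ k i) * r i) x).eval t = ((a.1 x) ^ k i) ^ 2 * (f i (x, t)) := by
        have h2 := congrArg (fun z => (pe z x).eval t) (hrs i)
        have ht' : eval t (Polynomial.map (ev A x) p) = 0 := ht
        simp only [pe, Polynomial.map_mul, Polynomial.map_add, eval_mul, eval_add, map_C, eval_C,
          ht', map_pow, Polynomial.map_pow, eval_pow, ev_apply] at h2 ⊢
        rw [hq i, pe]
        rw [mul_zero, add_zero] at h2
        rw [← h2]; ring
      rw [h1, sign_mul, sign_pos (by positivity), one_mul]
    constructor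
    · intro h
      exact ⟨fun i => SignType.sign (f i (x, t)), ⟨_, h, fun i => rfl⟩, hsg⟩
    · rintro ⟨σ, ⟨y0, h0, h1⟩, h2⟩
      refine (hsat y0 (x, t) fun i => ?_).1 h0
      rw [h1, ← h2 i, hsg i]

theorem root_bound {p : ℝ[X]} {d : ℕ} (hd : p.natDegree ≤ d) (h0 : p.coeff d ≠ 0) {t : ℝ}
    (ht : p.IsRoot t) : |t| < 2 + ∑ i ∈ Finset.range d, p.coeff i ^ 2 / p.coeff d ^ 2 := by
  have hdeg : p.natDegree = d := le_antisymm hd (le_natDegree_of_ne_zero h0)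
  have hp0 : p ≠ 0 := by rintro rfl; simp at h0
  have h : |t| < (p.cauchyBound : ℝ) := by
    have := NNReal.coe_lt_coe.2 (ht.norm_lt_cauchyBound hp0)
    rwa [coe_nnnorm, Real.norm_eq_abs] at this
  refine h.trans_le ?_
  rw [cauchyBound, leadingCoeff, hdeg]
  have hs : (0 : ℝ) ≤ ∑ i ∈ Finset.range d, p.coeff i ^ 2 / p.coeff d ^ 2 :=
    Finset.sum_nonneg fun i _ => by positivity
  obtain ⟨M, hM⟩ : ∃ M : NNReal, (M : ℝ) =
      1 + ∑ i ∈ Finset.range d, p.coeff i ^ 2 / p.coeff d ^ 2 :=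
    ⟨Real.toNNReal _, Real.coe_toNNReal _ (by positivity)⟩
  have key : ((Finset.range d).sup fun x => ‖p.coeff x‖₊) / ‖p.coeff d‖₊ ≤ M := by
    rw [div_le_iff₀ (by simpa [pos_iff_ne_zero] using h0)]
    refine Finset.sup_le fun i hi => ?_
    rw [← NNReal.coe_le_coe]
    push_cast
    have h1 : p.coeff i ^ 2 / p.coeff d ^ 2 ≤ ∑ i ∈ Finset.range d, p.coeff i ^ 2 / p.coeff d ^ 2 :=
      Finset.single_le_sum (f := fun i => p.coeff i ^ 2 / p.coeff d ^ 2)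
        (fun i _ => by positivity) hi
    have h2 : ‖p.coeff i‖ ≤ (1 + p.coeff i ^ 2 / p.coeff d ^ 2) * ‖p.coeff d‖ := by
      rw [← div_le_iff₀ (by simpa using h0), Real.norm_eq_abs, Real.norm_eq_abs, ← div_pow,
        ← sq_abs, abs_div]
      nlinarith [sq_nonneg (|p.coeff i| / |p.coeff d| - 1), abs_nonneg (p.coeff i),
        abs_nonneg (p.coeff d), div_nonneg (abs_nonneg (p.coeff i)) (abs_nonneg (p.coeff d))]
    refine h2.trans (mul_le_mul_of_nonneg_right ?_ (norm_nonneg _))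
    rw [hM]
    linarith
  have key' := NNReal.coe_le_coe.2 key
  rw [NNReal.coe_add]
  rw [hM] at key'
  push_cast at key' ⊢
  linarith

theorem elim_zero : Elim 0 := by
  intro X A p S hp hS
  refine (SA.const False).congr fun x => ?_
  simp only [false_iff]
  rintro ⟨h0, t, ht, -⟩
  have h1 := natDegree_map_le (f := ev A x) (p := p)
  rw [show p.map (ev A x) = pe p x from rfl] at h1
  have h2 := eq_C_of_natDegree_le_zero (h1.trans hp)
  rw [h2] at h0 ht
  simp at h0 ht
  exact h0 ht

theorem elim_of_top {e : ℕ} (he : Elim e)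
    (h : ∀ (X : Type) (A : Subalgebra ℝ (X → ℝ)) (p : Polynomial A)
      (S : X × ℝ → Prop), p.natDegree ≤ e + 1 → SA (ext A) S →
      SA A (fun x => (p.coeff (e + 1)).1 x ≠ 0 ∧ ∃ t, (pe p x).IsRoot t ∧ S (x, t))) :
    Elim (e + 1) := by
  intro X A p S hp hS
  set a := p.coeff (e + 1) with ha
  set p0 := p - monomial (e + 1) a with hp0
  have hd0 : p0.natDegree ≤ e := by
    rw [natDegree_le_iff_coeff_eq_zero]
    intro N hN
    rw [hp0, coeff_sub, coeff_monomial]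
    rcases Nat.lt_or_ge (e + 1) N with h | h
    · rw [if_neg (by omega), coeff_eq_zero_of_natDegree_lt (lt_of_le_of_lt hp h), sub_zero]
    · have : N = e + 1 := by omega
      rw [if_pos this.symm, this, ← ha, sub_self]
  have ha0 : SA A (fun x => a.1 x = 0) := SA.eq' (g := 0) a.2 (zero_mem A)
  refine ((ha0.and' (he X A p0 S hd0 hS)).or' (h X A p S hp hS)).congr fun x => ?_
  by_cases hx : a.1 x = 0
  · have : pe p0 x = pe p x := by
      rw [hp0, pe, pe, Polynomial.map_sub, map_monomial, ev_apply, hx]; simp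
    simp [hx, this]
    intro h; exact absurd hx h
  · have : pe p x ≠ 0 := by
      intro h0
      have := congrArg (fun q => q.coeff (e + 1)) h0
      simp [pe, coeff_map] at this
      exact hx this
    simp only [hx, this, false_and, false_or, ne_eq, not_false_eq_true, true_and]
    simp [← ha, hx]

theorem SA.at {S : X × ℝ → Prop} (hS : SA (ext A) S) {u : X → ℝ} (hu : u ∈ A) :
    SA A (fun x => S (x, u x)) :=
  hS.pullback (fun x => (x, u x)) fun _ hf => ext_subst hf id (fun _ h => h) hu

theorem elim_one : Elim 1 := by
  refine elim_of_top elim_zero fun X A p S hp hS => ?_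
  obtain ⟨m, r, S', hr, hS', hsat, hSS⟩ := reduceS p hp hS
  have ha0 : SA A (fun x => (p.coeff (0 + 1)).1 x = 0) := SA.eq' (g := 0) (p.coeff 1).2 (zero_mem A)
  refine (ha0.neg'.and' (hS'.at (zero_mem A))).congr fun x => and_congr_right fun hx => ?_
  have hind : ∀ t, S' (x, t) ↔ S' (x, 0) := fun t => hsat _ _ fun i => by
    have h1 := natDegree_map_le (f := ev A x) (p := r i)
    rw [show (r i).map (ev A x) = pe (r i) x from rfl] at h1
    rw [eq_C_of_natDegree_le_zero (h1.trans (hr i))]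
    simp
  constructor
  · intro h
    have hroot : (pe p x).IsRoot (-(p.coeff 0).1 x / (p.coeff (0 + 1)).1 x) := by
      have h1 := natDegree_map_le (f := ev A x) (p := p)
      rw [show p.map (ev A x) = pe p x from rfl] at h1
      rw [IsRoot.def, eq_X_add_C_of_natDegree_le_one (h1.trans hp)]
      simp [pe, coeff_map] at hx ⊢
      field_simp
      ring
    exact ⟨_, hroot, (hSS x _ hx hroot).2 ((hind _).2 h)⟩
  · rintro ⟨t, ht, h⟩
    exact (hind t).1 ((hSS x t hx ht).1 h)

end step
end SemiAlg
end

section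
open Polynomial
namespace SemiAlg
section step
variable {X : Type} {A : Subalgebra ℝ (X → ℝ)}

theorem ext_fst {F : X × ℝ → ℝ} (hF : F ∈ ext A) :
    (fun y : (X × ℝ) × ℝ => F (y.1.1, y.2)) ∈ ext (ext A) :=
  ext_subst hF (fun y : (X × ℝ) × ℝ => y.1.1) (fun _ hf => fst_mem_ext (fst_mem_ext hf)) snd_mem_ext

theorem elim_succ {e : ℕ} (he1 : 1 ≤ e) (he : Elim e) : Elim (e + 1) := by
  refine elim_of_top he fun X A p S hp hS => ?_
  obtain ⟨m, r, S', hr, hS', hsat, hSS⟩ := reduceS p hp hS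
  set a := p.coeff (e + 1) with ha
  have ha0 : SA A (fun x => a.1 x = 0) := SA.eq' (g := 0) a.2 (zero_mem A)
  set b : A := 2 * a ^ 2 + ∑ i ∈ Finset.range (e + 1), p.coeff i ^ 2 with hb
  -- auxiliary polynomials
  set Q : Fin m ⊕ Fin 3 → Polynomial A :=
    Sum.elim r ![derivative p, C (a ^ 2) * Polynomial.X - C b, C (a ^ 2) * Polynomial.X + C b] with hQ
  have hQd : ∀ i, (Q i).natDegree ≤ e := by
    rintro (i | i)
    · exact hr i
    · have h1 : (C (a ^ 2) * (Polynomial.X : Polynomial A)).natDegree ≤ 1 := (natDegree_C_mul_le _ _).trans natDegree_X_le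
      fin_cases i
      · exact (natDegree_derivative_le p).trans (by omega)
      · exact ((natDegree_sub_C (p := C (a ^ 2) * (Polynomial.X : Polynomial A))).le.trans h1).trans he1
      · exact ((natDegree_add_C (p := C (a ^ 2) * (Polynomial.X : Polynomial A))).le.trans h1).trans he1
  have hpe : (fun y : X × ℝ => (pe p y.1).eval y.2) ∈ ext A := eval_mem_ext p
  -- semialgebraicity of the elimination formula
  have hF1 : SA A (fun x => ∃ t ∈ Rt Q x, (pe p x).IsRoot t ∧ S' (x, t)) :=
    elimR he Q hQd (S := fun y => (pe p y.1).IsRoot y.2 ∧ S' y)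
      ((SA.eq' (g := 0) hpe (zero_mem _)).and' hS')
  have hmid : SA (ext (ext A)) (fun y => S' (y.1.1, (y.1.2 + y.2) / 2)) := by
    refine hS'.pullback (fun y : (X × ℝ) × ℝ => (y.1.1, (y.1.2 + y.2) / 2)) fun F hF => ?_
    have hu : (fun y : (X × ℝ) × ℝ => (y.1.2 + y.2) / 2) ∈ ext (ext A) := by
      have := Subalgebra.smul_mem _ (add_mem (fst_mem_ext (A := ext A) (snd_mem_ext (A := A)))
        (snd_mem_ext (A := ext A))) (1 / 2 : ℝ)
      convert this using 1
      funext y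
      simp
      ring
    exact ext_subst hF (fun y : (X × ℝ) × ℝ => y.1.1) (fun _ hf => fst_mem_ext (fst_mem_ext hf)) hu
  have hno : SA (ext (ext A)) (fun y => ∃ c ∈ Rt Q y.1.1, y.1.2 < c ∧ c < y.2) := by
    have := elimR he (fun i => lift (lift (Q i))) (fun i => (natDegree_lift _).trans
      ((natDegree_lift _).trans (hQd i))) (S := fun y => y.1.1.2 < y.2 ∧ y.2 < y.1.2)
      ((SA.lt' (fst_mem_ext (fst_mem_ext snd_mem_ext)) snd_mem_ext).and'
        (SA.lt' snd_mem_ext (fst_mem_ext snd_mem_ext)))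
    exact this.congr fun y => by rw [Rt_lift (fun i => lift (Q i)), Rt_lift]
  have hF2 : SA A (fun x => ∃ a ∈ Rt Q x, ∃ b ∈ Rt Q x,
      (a < b ∧ (pe p x).eval a * (pe p x).eval b < 0) ∧ S' (x, (a + b) / 2) ∧
        ¬ ∃ c ∈ Rt Q x, a < c ∧ c < b) := by
    refine elimR he Q hQd (S := fun y => ∃ b ∈ Rt Q y.1,
      (y.2 < b ∧ (pe p y.1).eval y.2 * (pe p y.1).eval b < 0) ∧ S' (y.1, (y.2 + b) / 2) ∧
        ¬ ∃ c ∈ Rt Q y.1, y.2 < c ∧ c < b) ?_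
    refine elimR2 he Q hQd (S := fun y =>
      (y.1.2 < y.2 ∧ (pe p y.1.1).eval y.1.2 * (pe p y.1.1).eval y.2 < 0) ∧
        S' (y.1.1, (y.1.2 + y.2) / 2) ∧ ¬ ∃ c ∈ Rt Q y.1.1, y.1.2 < c ∧ c < y.2) ?_
    refine SA.and' (SA.and' (SA.lt' (fst_mem_ext snd_mem_ext) snd_mem_ext) ?_) (hmid.and' hno.neg')
    exact SA.lt' (g := 0) (mul_mem (fst_mem_ext (A := ext A) hpe) (ext_fst hpe)) (zero_mem _)
  refine (ha0.neg'.and' (hF1.or' hF2)).congr fun x => and_congr_right fun hx => ?_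
  have hcoef : ∀ i, (pe p x).coeff i = (p.coeff i).1 x := fun i => by simp [pe, coeff_map]
  have hcd : (pe p x).coeff (e + 1) = a.1 x := hcoef _
  have hdeg : (pe p x).natDegree ≤ e + 1 := (natDegree_map_le (f := ev A x) (p := p)).trans hp
  have hbx : b.1 x = (a.1 x) ^ 2 * (2 + ∑ i ∈ Finset.range (e + 1),
      (pe p x).coeff i ^ 2 / (pe p x).coeff (e + 1) ^ 2) := by
    rw [hcd, ← Finset.sum_div, mul_add, mul_div_cancel₀ _ (pow_ne_zero 2 hx)]
    simp only [hcoef]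
    have := map_add (ev A x) (2 * a ^ 2) (∑ i ∈ Finset.range (e + 1), p.coeff i ^ 2)
    rw [map_sum] at this
    simp only [map_mul, map_pow, ev_apply] at this
    have h2 : (2 : A).1 x = 2 := map_ofNat (ev A x) 2
    rw [hb, this, h2]
    ring
  have hpx' : derivative (pe p x) = pe (derivative p) x := by rw [pe, pe, derivative_map]
  have hpx0 : pe (derivative p) x ≠ 0 := by
    intro h
    have := congrArg (fun q => q.coeff e) (hpx'.trans h)
    simp only [coeff_derivative, hcd, coeff_zero] at this
    rcases mul_eq_zero.1 this with h | h
    · exact hx h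
    · norm_cast at h
  have hcore := core (p := pe p x) (L := fun i => pe (r i) x) (R := Rt Q x) (Rt_finite Q x)
    (fun i => by
      by_cases h : pe (r i) x = 0
      · exact Or.inl h
      · exact Or.inr fun t ht => ⟨Sum.inl i, h, ht⟩)
    (fun t ht => ⟨Sum.inr 0, hpx0, by rw [hpx'] at ht; exact ht⟩)
    (fun t ht => by
      have hB := root_bound hdeg (by rw [hcd]; exact hx) ht
      set B := 2 + ∑ i ∈ Finset.range (e + 1), (pe p x).coeff i ^ 2 / (pe p x).coeff (e + 1) ^ 2
      have hne : ∀ q : Polynomial A, q.coeff 1 = a ^ 2 → pe q x ≠ 0 := by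
        intro q hq h
        have := congrArg (fun q => q.coeff 1) h
        simp [pe, coeff_map, hq] at this
        exact hx this
      refine ⟨⟨-B, ⟨Sum.inr 2, hne _ ?_, ?_⟩, (abs_lt.1 hB).1⟩,
        ⟨B, ⟨Sum.inr 1, hne _ ?_, ?_⟩, (abs_lt.1 hB).2⟩⟩
      · simp [hQ, -map_pow]
      · simp [hQ, pe, hbx]
      · simp [hQ, -map_pow]
      · simp [hQ, pe, hbx])
    (S := fun t => S' (x, t)) (fun t t' h => hsat (x, t) (x, t') h)
  rw [← hcore]
  exact exists_congr fun t => and_congr_right fun ht => (hSS x t hx ht).symm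

theorem elim_all : ∀ d, Elim d
  | 0 => elim_zero
  | 1 => elim_one
  | (d + 2) => elim_succ (by omega) (elim_all (d + 1))

/-- Tarski-Seidenberg for one variable. -/
theorem SA.proj {S : X × ℝ → Prop} (hS : SA (ext A) S) : SA A (fun x => ∃ t, S (x, t)) := by
  obtain ⟨m, f, hf, hsat⟩ := hS.sat
  choose q hq using hf
  obtain ⟨d, hd⟩ : ∃ d, ∀ i, (q i).natDegree ≤ d := by
    refine ⟨Finset.univ.sup fun i => (q i).natDegree, fun i => ?_⟩
    exact Finset.le_sup (f := fun i => (q i).natDegree) (Finset.mem_univ i)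
  have he := elim_all d
  have hsub : ∀ u : X × ℝ → ℝ, u ∈ ext A → SA (ext A) (fun y => S (y.1, u y)) := fun u hu =>
    hS.pullback (fun y : X × ℝ => (y.1, u y)) fun F hF =>
      ext_subst hF (fun y : X × ℝ => y.1) (fun _ hf => fst_mem_ext hf) hu
  have hmid : SA (ext (ext A)) (fun y => S (y.1.1, (y.1.2 + y.2) / 2)) := by
    refine hS.pullback (fun y : (X × ℝ) × ℝ => (y.1.1, (y.1.2 + y.2) / 2)) fun F hF => ?_
    have hu : (fun y : (X × ℝ) × ℝ => (y.1.2 + y.2) / 2) ∈ ext (ext A) := by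
      have := Subalgebra.smul_mem _ (add_mem (fst_mem_ext (A := ext A) (snd_mem_ext (A := A)))
        (snd_mem_ext (A := ext A))) (1 / 2 : ℝ)
      convert this using 1
      funext y
      simp
      ring
    exact ext_subst hF (fun y : (X × ℝ) × ℝ => y.1.1) (fun _ hf => fst_mem_ext (fst_mem_ext hf)) hu
  have h1 : SA A (fun x => ∃ t ∈ Rt q x, S (x, t)) := elimR he q hd hS
  have h2 : SA A (fun x => ∃ t ∈ Rt q x, S (x, t + 1)) :=
    elimR he q hd (hsub (fun y => y.2 + 1) (add_mem snd_mem_ext (one_mem _)))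
  have h3 : SA A (fun x => ∃ t ∈ Rt q x, S (x, t - 1)) :=
    elimR he q hd (hsub (fun y => y.2 - 1) (sub_mem snd_mem_ext (one_mem _)))
  have h4 : SA A (fun x => S (x, 0)) := hS.at (zero_mem A)
  have h5 : SA A (fun x => ∃ a ∈ Rt q x, ∃ b ∈ Rt q x, S (x, (a + b) / 2)) :=
    elimR he q hd (elimR2 he q hd hmid)
  refine (h1.or' (h2.or' (h3.or' (h4.or' h5)))).congr fun x => ?_
  constructor
  · rintro (⟨t, -, h⟩ | ⟨t, -, h⟩ | ⟨t, -, h⟩ | h | ⟨a, -, b, -, h⟩) <;> exact ⟨_, h⟩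
  rintro ⟨t, ht⟩
  by_cases htR : t ∈ Rt q x
  · exact Or.inl ⟨t, htR, ht⟩
  have hfin := Rt_finite q x
  have hsig : ∀ a b, (∀ c ∈ Rt q x, a < c → c < b → False) → ∀ s, (a < s ∧ s < b) →
      (a < t ∧ t < b) → S (x, s) := by
    intro a b hn s hs ht'
    refine (hsat (x, t) (x, s) fun i => ?_).1 ht
    rw [hq, hq]
    refine sign_const ?_ ht' hs
    by_cases h : pe (q i) x = 0
    · exact Or.inl h
    · exact Or.inr fun u h1 h2 h3 => hn u ⟨i, h, h3⟩ h1 h2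
  by_cases hl : ∃ a ∈ Rt q x, a < t <;> by_cases hr : ∃ b ∈ Rt q x, t < b
  · obtain ⟨a, haR, hat, ha⟩ := exists_nearest_left hfin hl
    obtain ⟨b, hbR, htb, hb⟩ := exists_nearest_right hfin hr
    refine Or.inr (Or.inr (Or.inr (Or.inr ⟨a, haR, b, hbR, hsig a b ?_ _ ⟨by linarith, by linarith⟩
      ⟨hat, htb⟩⟩)))
    intro c hc h1 h2
    rcases lt_trichotomy c t with h | h | h
    · exact absurd (ha c hc h) (not_le.2 h1)
    · exact htR (h ▸ hc)
    · exact absurd (hb c hc h) (not_le.2 h2)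
  · obtain ⟨a, haR, hat, ha⟩ := exists_nearest_left hfin hl
    refine Or.inr (Or.inl ⟨a, haR, hsig a (max t (a + 1) + 1) ?_ _
      ⟨by linarith, by linarith [le_max_right t (a + 1)]⟩ ⟨hat, by linarith [le_max_left t (a + 1)]⟩⟩)
    intro c hc h1 _
    rcases lt_trichotomy c t with h | h | h
    · exact absurd (ha c hc h) (not_le.2 h1)
    · exact htR (h ▸ hc)
    · exact hr ⟨c, hc, h⟩
  · obtain ⟨b, hbR, htb, hb⟩ := exists_nearest_right hfin hr
    refine Or.inr (Or.inr (Or.inl ⟨b, hbR, hsig (min t (b - 1) - 1) b ?_ _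
      ⟨by linarith [min_le_right t (b - 1)], by linarith⟩ ⟨by linarith [min_le_left t (b - 1)], htb⟩⟩))
    intro c hc _ h2
    rcases lt_trichotomy c t with h | h | h
    · exact hl ⟨c, hc, h⟩
    · exact htR (h ▸ hc)
    · exact absurd (hb c hc h) (not_le.2 h2)
  · refine Or.inr (Or.inr (Or.inr (Or.inl (hsig (-(|t| + 1)) (|t| + 1) ?_ _
      ⟨by linarith [abs_nonneg t], by linarith [abs_nonneg t]⟩
      ⟨by linarith [neg_abs_le t], by linarith [le_abs_self t]⟩))))
    intro c hc _ _
    rcases lt_trichotomy c t with h | h | h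
    · exact hl ⟨c, hc, h⟩
    · exact htR (h ▸ hc)
    · exact hr ⟨c, hc, h⟩

end step

section multi
variable {X : Type} {A : Subalgebra ℝ (X → ℝ)}

/-- Functions polynomial in `n` further variables. -/
def extn (A : Subalgebra ℝ (X → ℝ)) (n : ℕ) : Subalgebra ℝ (X × (Fin n → ℝ) → ℝ) :=
  Algebra.adjoin ℝ ({F | ∃ f ∈ A, F = fun y => f y.1} ∪ {F | ∃ i, F = fun y => y.2 i})

theorem extn_fst {n : ℕ} {f : X → ℝ} (hf : f ∈ A) : (fun y => f y.1) ∈ extn A n :=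
  Algebra.subset_adjoin (Or.inl ⟨f, hf, rfl⟩)

theorem extn_snd {n : ℕ} (i : Fin n) : (fun y => y.2 i) ∈ extn A n :=
  Algebra.subset_adjoin (Or.inr ⟨i, rfl⟩)

theorem extn_pull {Y : Type} {B : Subalgebra ℝ (Y → ℝ)} {n : ℕ} (g : Y → X × (Fin n → ℝ))
    (h1 : ∀ f ∈ A, (fun y => f (g y).1) ∈ B) (h2 : ∀ i, (fun y => (g y).2 i) ∈ B) :
    ∀ F ∈ extn A n, F ∘ g ∈ B := by
  intro F hF
  induction hF using Algebra.adjoin_induction with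
  | mem F h =>
    rcases h with ⟨f, hf, rfl⟩ | ⟨i, rfl⟩
    · exact h1 f hf
    · exact h2 i
  | algebraMap r => exact B.algebraMap_mem r
  | add F G _ _ hF hG => exact add_mem hF hG
  | mul F G _ _ hF hG => exact mul_mem hF hG

theorem SA.projn {n : ℕ} : ∀ {S : X × (Fin n → ℝ) → Prop}, SA (extn A n) S →
    SA A (fun x => ∃ v, S (x, v)) := by
  induction n with
  | zero =>
    intro S hS
    have := hS.pullback (B := A) (fun x => (x, Fin.elim0)) (extn_pull _ (fun f hf => hf) fun i => i.elim0)
    refine this.congr fun x => ⟨fun h => ⟨_, h⟩, fun ⟨v, h⟩ => ?_⟩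
    rwa [Subsingleton.elim (Fin.elim0) v]
  | succ n ih =>
    intro S hS
    have h1 := hS.pullback (B := ext (extn A n)) (fun y => (y.1.1, Fin.cons y.2 y.1.2))
      (extn_pull _ (fun f hf => fst_mem_ext (extn_fst hf)) fun i => by
        refine Fin.cases ?_ (fun i => ?_) i
        · exact snd_mem_ext
        · exact fst_mem_ext (extn_snd i))
    refine (ih h1.proj).congr fun x => ⟨fun ⟨v, t, h⟩ => ⟨_, h⟩, fun ⟨v, h⟩ => ⟨Fin.tail v, v 0, ?_⟩⟩
    simpa using h

theorem SA.projn_all {n : ℕ} {S : X × (Fin n → ℝ) → Prop} (h : SA (extn A n) S) :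
    SA A (fun x => ∀ v, S (x, v)) :=
  h.neg'.projn.neg'.congr fun x => by simp

end multi
end SemiAlg
end

section
open Polynomial Filter Topology
namespace SemiAlg

theorem isSemialgebraic_SA {n : ℕ} {S : Set (Fin n → ℝ)} (hS : IsSemialgebraic S) {Y : Type}
    {B : Subalgebra ℝ (Y → ℝ)} (g : Y → Fin n → ℝ) (hg : ∀ i, (fun y => g y i) ∈ B) :
    SA B (fun y => g y ∈ S) := by
  have hev : ∀ p : MvPolynomial (Fin n) ℝ, (fun y => MvPolynomial.eval (g y) p) ∈ B := by
    intro p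
    induction p using MvPolynomial.induction_on with
    | C r => simp only [MvPolynomial.eval_C]; exact B.algebraMap_mem r
    | add p q hp hq => simp only [map_add]; exact add_mem hp hq
    | mul_X p i hp => simp only [map_mul, MvPolynomial.eval_X]; exact mul_mem hp (hg i)
  obtain ⟨m, p, Q, rfl⟩ := hS
  have h : SA B (fun y => ∃ i, MvPolynomial.eval (g y) (p i) = 0 ∧
      ∀ q : Q i, 0 < MvPolynomial.eval (g y) q.1) :=
    SA.existsFin fun i => (SA.eq' (g := 0) (hev _) (zero_mem B)).and'
      (SA.forallFin fun q => SA.pos _ (hev _))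
  exact h.congr fun y => by simp

/-- polynomial functions of one variable -/
noncomputable def A1 : Subalgebra ℝ (ℝ → ℝ) := (aeval (id : ℝ → ℝ) : ℝ[X] →ₐ[ℝ] (ℝ → ℝ)).range

theorem mem_A1 {f : ℝ → ℝ} (hf : f ∈ A1) : ∃ r : ℝ[X], ∀ s, f s = r.eval s := by
  obtain ⟨r, rfl⟩ := hf
  refine ⟨r, fun s => ?_⟩
  induction r using Polynomial.induction_on' with
  | add p q hp hq => simp_all
  | monomial k a => simp [← C_mul_X_pow_eq_monomial]

theorem id_mem_A1 : (fun s => s) ∈ A1 := ⟨Polynomial.X, by simp; rfl⟩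

theorem poly_lower (m : ℕ) : ∀ r : ℝ[X], r.natDegree < m → r ≠ 0 →
    ∃ e : ℕ, ∀ᶠ s in 𝓝[>] (0 : ℝ), s ^ e ≤ |r.eval s| := by
  induction m with
  | zero => intro r h; omega
  | succ m ih =>
    intro r hr hr0
    by_cases h0 : r.coeff 0 = 0
    · have hX : r = r.divX * Polynomial.X := by
        conv_lhs => rw [← divX_mul_X_add r, h0]
        simp
      have hd0 : r.divX ≠ 0 := by
        intro h; rw [h, zero_mul] at hX; exact hr0 hX
      have hm : r.divX.natDegree < m := by
        have : r.natDegree ≠ 0 := by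
          intro h
          rw [eq_C_of_natDegree_eq_zero h, h0] at hr0
          simp at hr0
        rw [natDegree_divX_eq_natDegree_tsub_one]
        omega
      obtain ⟨e, he⟩ := ih _ hm hd0
      refine ⟨e + 1, ?_⟩
      filter_upwards [he, self_mem_nhdsWithin] with s hs hs0
      have hs0' : 0 < s := hs0
      rw [hX, eval_mul, eval_X, abs_mul, abs_of_pos hs0', pow_succ]
      exact mul_le_mul_of_nonneg_right hs hs0'.le
    · refine ⟨1, ?_⟩
      have hc : Tendsto (fun s => |r.eval s| - s) (𝓝[>] (0 : ℝ)) (𝓝 (|r.eval 0| - 0)) :=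
        ((r.continuous.abs.sub continuous_id).tendsto 0).mono_left nhdsWithin_le_nhds
      have hp : 0 < |r.eval 0| - 0 := by
        rw [← coeff_zero_eq_eval_zero]; simpa using h0
      filter_upwards [hc.eventually (lt_mem_nhds hp)] with s hs
      simp only [pow_one]; linarith

theorem pe_continuous (P : Polynomial A1) : Continuous (fun y : ℝ × ℝ => (pe P y.1).eval y.2) := by
  have : (fun y : ℝ × ℝ => (pe P y.1).eval y.2) =
      fun y => ∑ i ∈ Finset.range (P.natDegree + 1), (P.coeff i).1 y.1 * y.2 ^ i := by
    funext y
    rw [pe, eval_map, eval₂_eq_sum_range]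
    simp
  rw [this]
  refine continuous_finsetSum _ fun i _ => ?_
  obtain ⟨r, hr⟩ := mem_A1 (P.coeff i).2
  simp only [hr]
  exact (r.continuous.comp continuous_fst).mul (continuous_snd.pow i)

theorem sign_stable (m : ℕ) : ∀ P : Polynomial A1, P.natDegree < m →
    ∃ N : ℕ, ∀ᶠ s in 𝓝[>] (0 : ℝ), ∀ t t', 0 < t → t < s ^ N → 0 < t' → t' < s ^ N →
      SignType.sign ((pe P s).eval t) = SignType.sign ((pe P s).eval t') := by
  induction m with
  | zero => intro P h; omega
  | succ m ih =>
    intro P hP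
    have hdec : ∀ s t, (pe P s).eval t = (pe P.divX s).eval t * t + (P.coeff 0).1 s := by
      intro s t
      conv_lhs => rw [← divX_mul_X_add P]
      simp [pe]
    by_cases h0 : P.coeff 0 = 0
    · by_cases hz : P = 0
      · exact ⟨0, by simp [hz, pe]⟩
      have hm : P.divX.natDegree < m := by
        have : P.natDegree ≠ 0 := by
          intro h
          rw [eq_C_of_natDegree_eq_zero h, h0] at hz
          simp at hz
        rw [natDegree_divX_eq_natDegree_tsub_one]
        omega
      obtain ⟨N, hN⟩ := ih _ hm
      refine ⟨N, ?_⟩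
      filter_upwards [hN] with s hs t t' h1 h2 h3 h4
      rw [hdec, hdec, h0]
      simp only [ZeroMemClass.coe_zero, Pi.zero_apply, add_zero, sign_mul, sign_pos h1, sign_pos h3,
        mul_one]
      exact hs t t' h1 h2 h3 h4
    · obtain ⟨r, hr⟩ := mem_A1 (P.coeff 0).2
      have hr0 : r ≠ 0 := by
        rintro rfl
        exact h0 (Subtype.ext (funext fun s => by simpa using hr s))
      obtain ⟨e, he⟩ := poly_lower _ r (Nat.lt_succ_self _) hr0
      obtain ⟨K, hK⟩ := (isCompact_Icc (a := (0 : ℝ)) (b := 1)).prod (isCompact_Icc (a := (0 : ℝ)) (b := 1))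
        |>.exists_bound_of_continuousOn (pe_continuous P.divX).continuousOn
      refine ⟨e + 1, ?_⟩
      have hs1 : ∀ᶠ s in 𝓝[>] (0 : ℝ), s < 1 :=
        nhdsWithin_le_nhds (eventually_lt_nhds one_pos)
      have hs2 : ∀ᶠ s in 𝓝[>] (0 : ℝ), |K| * s < 1 := by
        have : Tendsto (fun s => |K| * s) (𝓝[>] (0 : ℝ)) (𝓝 (|K| * 0)) :=
          ((continuous_const.mul continuous_id).tendsto 0).mono_left nhdsWithin_le_nhds
        exact this.eventually (gt_mem_nhds (by simp))
      filter_upwards [he, hs1, hs2, self_mem_nhdsWithin] with s hes h1 h2 hs0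
      have hs0' : 0 < s := hs0
      have key : ∀ t, 0 < t → t < s ^ (e + 1) →
          SignType.sign ((pe P s).eval t) = SignType.sign (r.eval s) := by
        intro t ht0 ht
        have ht1 : t ≤ 1 := ht.le.trans (pow_le_one₀ hs0'.le h1.le)
        have hb : |(pe P.divX s).eval t| ≤ |K| :=
          (hK (s, t) ⟨⟨hs0'.le, h1.le⟩, ⟨ht0.le, ht1⟩⟩).trans (le_abs_self K)
        have hb2 : |(pe P.divX s).eval t * t| < |r.eval s| := by
          rw [abs_mul, abs_of_pos ht0]
          have hse : 0 < s ^ e := pow_pos hs0' e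
          calc |(pe P.divX s).eval t| * t ≤ |K| * s ^ (e + 1) :=
                mul_le_mul hb ht.le ht0.le (abs_nonneg K)
            _ = s ^ e * (|K| * s) := by ring
            _ < s ^ e * 1 := mul_lt_mul_of_pos_left h2 hse
            _ ≤ |r.eval s| := by rw [mul_one]; exact hes
        rw [hdec, hr]
        rcases lt_trichotomy (r.eval s) 0 with h | h | h
        · rw [abs_of_neg h] at hb2
          rw [sign_neg h, sign_neg]
          linarith [(abs_lt.1 hb2).2]
        · rw [h, abs_zero] at hb2
          exact absurd hb2 (not_lt.2 (abs_nonneg _))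
        · rw [abs_of_pos h] at hb2
          rw [sign_pos h, sign_pos]
          linarith [(abs_lt.1 hb2).1]
      intro t t' a b c d
      rw [key t a b, key t' c d]

/-- Curve-selection substitute: a semialgebraic planar relation which is false for all small `t`
(depending on `s`) is false for `t < s ^ N`. -/
theorem planar {D : ℝ × ℝ → Prop} (hD : SA (ext A1) D)
    (h : ∀ s, 0 < s → ∃ τ, 0 < τ ∧ ∀ t, 0 < t → t < τ → ¬ D (s, t)) :
    ∃ N : ℕ, ∀ᶠ s in 𝓝[>] (0 : ℝ), ∀ t, 0 < t → t < s ^ N → ¬ D (s, t) := by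
  obtain ⟨m, f, hf, hsat⟩ := hD.sat
  choose P hP using hf
  choose N hN using fun i => sign_stable _ (P i) (Nat.lt_succ_self _)
  refine ⟨Finset.univ.sup N, ?_⟩
  have hs1 : ∀ᶠ s in 𝓝[>] (0 : ℝ), s < 1 :=
    nhdsWithin_le_nhds (eventually_lt_nhds one_pos)
  filter_upwards [eventually_all.2 hN, hs1, self_mem_nhdsWithin] with s hs h1 hs0 t ht0 ht hDt
  have hs0' : 0 < s := hs0
  obtain ⟨τ, hτ, hτ'⟩ := h s hs0'
  have hle : ∀ i, s ^ (Finset.univ.sup N) ≤ s ^ N i := fun i =>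
    pow_le_pow_of_le_one hs0'.le h1.le (Finset.le_sup (Finset.mem_univ i))
  have ht'0 : 0 < min t (τ / 2) := lt_min ht0 (by linarith)
  refine hτ' (min t (τ / 2)) ht'0 (lt_of_le_of_lt (min_le_right _ _) (by linarith)) ?_
  refine (hsat (s, t) (s, min t (τ / 2)) fun i => ?_).1 hDt
  rw [hP, hP]
  exact hs i t _ ht0 (ht.trans_le (hle i)) ht'0 (lt_of_le_of_lt (min_le_left _ _) (ht.trans_le (hle i)))

theorem closure_inter_sub {n : ℕ} {X U : Set (Fin n → ℝ)} (h : IsClosed ((Subtype.val ⁻¹' X : Set ↥U))) {x}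
    (hx : x ∈ closure X) (hxU : x ∈ U) (hXU : X ⊆ U) : x ∈ X := by
  have h1 : (⟨x, hxU⟩ : U) ∈ closure (Subtype.val ⁻¹' X : Set ↥U) := by
    rw [closure_subtype]
    rwa [Subtype.image_preimage_coe, Set.inter_eq_right.2 hXU]
  rw [h.closure_eq] at h1
  exact h1

theorem loja {n : ℕ} (X U V : Set (Fin n → ℝ))
    (hXsa : IsSemialgebraic X) (hUsa : IsSemialgebraic U)
    (hVo : IsOpen V) (hVsa : IsSemialgebraic V)
    (hXU : X ⊆ U) (hXV : X ⊆ V)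
    (hXclU : IsClosed ((Subtype.val ⁻¹' X : Set ↥U))) :
    ∃ N : ℕ, ∀ᶠ s in 𝓝[>] (0 : ℝ), ∀ x ∈ X, s * ‖x‖ ≤ 1 → (∀ z ∉ U, s ≤ dist x z) →
      ∀ y ∉ V, s ^ N ≤ dist x y := by
  set D : ℝ × ℝ → Prop := fun w => ∃ x : Fin n → ℝ, x ∈ X ∧ (∀ i, w.1 * x i ≤ 1 ∧ -1 ≤ w.1 * x i) ∧
    (∀ z : Fin n → ℝ, z ∈ U ∨ ∃ i, w.1 ≤ x i - z i ∨ w.1 ≤ z i - x i) ∧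
    ∃ y : Fin n → ℝ, y ∉ V ∧ ∀ i, x i - y i ≤ w.2 ∧ y i - x i ≤ w.2 with hDdef
  have hDSA : SA (ext A1) D := by
    have hs : (fun w : ℝ × ℝ => w.1) ∈ ext A1 := fst_mem_ext id_mem_A1
    have ht : (fun w : ℝ × ℝ => w.2) ∈ ext A1 := snd_mem_ext
    refine SA.projn (S := fun q : (ℝ × ℝ) × (Fin n → ℝ) => q.2 ∈ X ∧ (∀ i, q.1.1 * q.2 i ≤ 1 ∧ -1 ≤ q.1.1 * q.2 i) ∧
      (∀ z : Fin n → ℝ, z ∈ U ∨ ∃ i, q.1.1 ≤ q.2 i - z i ∨ q.1.1 ≤ z i - q.2 i) ∧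
      ∃ y : Fin n → ℝ, y ∉ V ∧ ∀ i, q.2 i - y i ≤ q.1.2 ∧ y i - q.2 i ≤ q.1.2) ?_
    refine SA.and' (isSemialgebraic_SA hXsa _ extn_snd) (SA.and' ?_ (SA.and' ?_ ?_))
    · refine SA.forallFin fun i => SA.and' ?_ ?_
      · exact SA.le' (g := 1) (mul_mem (extn_fst hs) (extn_snd i)) (one_mem _)
      · exact SA.le' (f := -1) (neg_mem (one_mem _)) (mul_mem (extn_fst hs) (extn_snd i))
    · refine SA.projn_all (S := fun q : ((ℝ × ℝ) × (Fin n → ℝ)) × (Fin n → ℝ) => q.2 ∈ U ∨ ∃ i, q.1.1.1 ≤ q.1.2 i - q.2 i ∨ q.1.1.1 ≤ q.2 i - q.1.2 i) ?_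
      refine SA.or' (isSemialgebraic_SA hUsa _ extn_snd) (SA.existsFin fun i => SA.or' ?_ ?_)
      · exact SA.le' (extn_fst (extn_fst hs)) (sub_mem (extn_fst (extn_snd i)) (extn_snd i))
      · exact SA.le' (extn_fst (extn_fst hs)) (sub_mem (extn_snd i) (extn_fst (extn_snd i)))
    · refine SA.projn (S := fun q : ((ℝ × ℝ) × (Fin n → ℝ)) × (Fin n → ℝ) => q.2 ∉ V ∧ ∀ i, q.1.2 i - q.2 i ≤ q.1.1.2 ∧ q.2 i - q.1.2 i ≤ q.1.1.2) ?_
      refine SA.and' (isSemialgebraic_SA hVsa _ extn_snd).neg' (SA.forallFin fun i => SA.and' ?_ ?_)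
      · exact SA.le' (sub_mem (extn_fst (extn_snd i)) (extn_snd i)) (extn_fst (extn_fst ht))
      · exact SA.le' (sub_mem (extn_snd i) (extn_fst (extn_snd i))) (extn_fst (extn_fst ht))
  have hDiff : ∀ s t, 0 < s → 0 < t → (D (s, t) ↔ ∃ x ∈ X, s * ‖x‖ ≤ 1 ∧ (∀ z ∉ U, s ≤ dist x z) ∧
      ∃ y ∉ V, dist x y ≤ t) := by
    intro s t hs ht
    simp only [hDdef]
    refine exists_congr fun x => and_congr_right fun _ => and_congr ?_ (and_congr ?_ ?_)
    · rw [← le_div_iff₀' hs, pi_norm_le_iff_of_nonneg (by positivity)]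
      refine forall_congr' fun i => ?_
      rw [Real.norm_eq_abs, abs_le, le_div_iff₀' hs, ← neg_div, div_le_iff₀' hs]
      tauto
    · refine forall_congr' fun z => ?_
      rw [← not_lt, dist_pi_lt_iff hs]
      simp only [Real.dist_eq, abs_lt, not_forall, not_and_or, not_lt]
      have : ∀ i, (x i - z i ≤ -s ∨ s ≤ x i - z i) ↔ (s ≤ x i - z i ∨ s ≤ z i - x i) := by
        intro i
        constructor
        · rintro (h | h)
          · right; linarith
          · left; linarith
        · rintro (h | h)
          · right; linarith
          · left; linarith
      simp only [this]
      exact or_iff_not_imp_left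
    · refine exists_congr fun y => and_congr_right fun _ => ?_
      rw [dist_pi_le_iff ht.le]
      refine forall_congr' fun i => ?_
      rw [Real.dist_eq, abs_le]
      constructor
      · rintro ⟨h1, h2⟩; exact ⟨by linarith, h1⟩
      · rintro ⟨h1, h2⟩; exact ⟨h2, by linarith⟩
  obtain ⟨N, hN⟩ := planar hDSA (by
    intro s hs
    set K : Set (Fin n → ℝ) := {x | x ∈ closure X ∧ ‖x‖ ≤ 1 / s ∧ ∀ z ∉ U, s ≤ dist x z} with hK
    have hKc : IsCompact K := by
      refine Metric.isCompact_of_isClosed_isBounded ?_ ?_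
      · refine isClosed_closure.inter (IsClosed.inter (isClosed_le continuous_norm continuous_const) ?_)
        have : {x : Fin n → ℝ | ∀ z ∉ U, s ≤ dist x z} = ⋂ z ∈ Uᶜ, {x | s ≤ dist x z} := by
          ext x; simp
        change IsClosed {x : Fin n → ℝ | ∀ z ∉ U, s ≤ dist x z}
        rw [this]
        exact isClosed_biInter fun z _ => isClosed_le continuous_const (continuous_id.dist continuous_const)
      · refine Metric.isBounded_closedBall (x := (0 : Fin n → ℝ)) (r := 1 / s) |>.subset fun x hx => ?_
        simpa using hx.2.1
    have hKV : K ⊆ V := by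
      intro x hx
      have hxU : x ∈ U := by
        by_contra hxU
        have := hx.2.2 x hxU
        rw [dist_self] at this
        linarith
      exact hXV (closure_inter_sub hXclU hx.1 hxU hXU)
    obtain ⟨δ, hδ, hsub⟩ := hKc.exists_thickening_subset_open hVo hKV
    refine ⟨δ, hδ, fun t ht0 ht hD => ?_⟩
    obtain ⟨x, hxX, h1, h2, y, hy, hxy⟩ := (hDiff s t hs ht0).1 hD
    refine hy (hsub (Metric.mem_thickening_iff.2 ⟨x, ⟨subset_closure hxX, ?_, h2⟩, ?_⟩))
    · rwa [le_div_iff₀' hs]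
    · rw [dist_comm]; exact hxy.trans_lt ht)
  refine ⟨N, ?_⟩
  filter_upwards [hN, self_mem_nhdsWithin] with s hs hs0 x hx h1 h2 y hy
  have hs0' : 0 < s := hs0
  by_contra hlt
  push Not at hlt
  have hp : 0 < s ^ N := pow_pos hs0' N
  have ht0 : 0 < max (dist x y) (s ^ N / 2) := lt_max_of_lt_right (by linarith)
  exact hs (max (dist x y) (s ^ N / 2)) ht0 (max_lt hlt (by linarith))
    ((hDiff s _ hs0' ht0).2 ⟨x, hx, h1, h2, y, hy, le_max_left _ _⟩)

end SemiAlg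
end

section
open Polynomial Filter Topology
namespace SemiAlg

open MeasureTheory ContDiff in
theorem conv_bound {n : ℕ} (k : ℕ) : ∀ (F F' : Type) [NormedAddCommGroup F] [NormedSpace ℝ F]
    [NormedAddCommGroup F'] [NormedSpace ℝ F']
    (b : (Fin n → ℝ) → F) (_ : ContDiff ℝ ∞ b) (_ : HasCompactSupport b)
    (L : F →L[ℝ] ℝ →L[ℝ] F'), ∃ C : ℝ, ∀ g : (Fin n → ℝ) → ℝ, LocallyIntegrable g volume →
      (∀ x, ‖g x‖ ≤ 1) → ∀ x, ‖iteratedFDeriv ℝ k (convolution b g L volume) x‖ ≤ C := by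
  induction k with
  | zero =>
    intro F F' _ _ _ _ b hb hc L
    refine ⟨∫ t, ‖L‖ * ‖b t‖, fun g hg hg1 x => ?_⟩
    rw [norm_iteratedFDeriv_zero]
    refine norm_integral_le_of_norm_le ?_ ?_
    · exact ((hb.continuous.integrable_of_hasCompactSupport hc).norm).const_mul _
    · refine Filter.Eventually.of_forall fun t => ?_
      refine (L.le_opNorm₂ _ _).trans ?_
      have := hg1 (x - t)
      have h0 : 0 ≤ ‖L‖ * ‖b t‖ := by positivity
      nlinarith
  | succ k ih =>
    intro F F' _ _ _ _ b hb hc L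
    obtain ⟨C, hC⟩ := ih _ _ (fderiv ℝ b) (hb.fderiv_right (by simp)) (hc.fderiv ℝ)
      (L.precompL (Fin n → ℝ))
    refine ⟨C, fun g hg hg1 x => ?_⟩
    rw [← norm_iteratedFDeriv_fderiv]
    have : fderiv ℝ (convolution b g L volume)
        = convolution (fderiv ℝ b) g (L.precompL (Fin n → ℝ)) volume := by
      ext1 x
      exact (hc.hasFDerivAt_convolution_left L (hb.of_le (by simp)) hg x).fderiv
    rw [this]
    exact hC g hg hg1 x

open MeasureTheory ContDiff in
theorem cutoff_unit (n : ℕ) : ∃ C : ℕ → ℝ, (∀ k, 0 ≤ C k) ∧ ∀ A : Set (Fin n → ℝ),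
    ∃ f : (Fin n → ℝ) → ℝ, ContDiff ℝ ∞ f ∧ (∀ x ∈ A, f x = 1) ∧
      (∀ x, (∀ a ∈ A, 1 ≤ dist x a) → f x = 0) ∧ ∀ k x, ‖iteratedFDeriv ℝ k f x‖ ≤ C k := by
  let b : ContDiffBump (0 : Fin n → ℝ) := ⟨1/4, 1/2, by norm_num, by norm_num⟩
  have hb : ContDiff ℝ ∞ (b.normed volume) := b.contDiff_normed
  have hc : HasCompactSupport (b.normed volume) := b.hasCompactSupport_normed
  choose C hC using fun k => conv_bound (n := n) k ℝ ℝ (b.normed volume) hb hc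
    (ContinuousLinearMap.lsmul ℝ ℝ)
  refine ⟨fun k => |C k|, fun k => abs_nonneg _, fun A => ?_⟩
  set g : (Fin n → ℝ) → ℝ := (Metric.thickening (1/2) A).indicator (fun _ => 1) with hg
  have hgm : Measurable g := measurable_const.indicator Metric.isOpen_thickening.measurableSet
  have hg1 : ∀ x, ‖g x‖ ≤ 1 := by
    intro x
    by_cases hx : x ∈ Metric.thickening (1/2) A
    · rw [hg, Set.indicator_of_mem hx]; simp
    · rw [hg, Set.indicator_of_notMem hx]; simp
  have hgl : LocallyIntegrable g volume := by
    have h1 : LocallyIntegrable (fun _ : Fin n → ℝ => (1 : ℝ)) volume := locallyIntegrable_const 1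
    exact h1.mono hgm.aestronglyMeasurable (Filter.Eventually.of_forall fun x => by simpa using hg1 x)
  refine ⟨convolution (b.normed volume) g (ContinuousLinearMap.lsmul ℝ ℝ) volume,
    hc.contDiff_convolution_left _ hb hgl, ?_, ?_, fun k x => (hC k g hgl hg1 x).trans (le_abs_self _)⟩
  · intro x hx
    have h1 : ∀ y ∈ Metric.ball x (1/2), g y = 1 := by
      intro y hy
      exact Set.indicator_of_mem (Metric.mem_thickening_iff.2 ⟨x, hx, hy⟩) _
    have hx1 : g x = 1 := h1 x (Metric.mem_ball_self (by norm_num))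
    rw [ContDiffBump.normed_convolution_eq_right, hx1]
    intro y hy
    rw [hx1]; exact h1 y hy
  · intro x hx
    have h1 : ∀ y ∈ Metric.ball x (1/2), g y = 0 := by
      intro y hy
      refine Set.indicator_of_notMem (fun hy' => ?_) _
      obtain ⟨a, ha, hya⟩ := Metric.mem_thickening_iff.1 hy'
      have := hx a ha
      have h2 := dist_triangle x y a
      rw [Metric.mem_ball, dist_comm] at hy
      linarith
    have hx1 : g x = 0 := h1 x (Metric.mem_ball_self (by norm_num))
    rw [ContDiffBump.normed_convolution_eq_right, hx1]
    intro y hy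
    rw [hx1]; exact h1 y hy

open ContDiff in
theorem cutoff (n : ℕ) : ∃ C : ℕ → ℝ, (∀ k, 0 ≤ C k) ∧ ∀ (A : Set (Fin n → ℝ)) (r : ℝ), 0 < r →
    ∃ f : (Fin n → ℝ) → ℝ, ContDiff ℝ ∞ f ∧ (∀ x ∈ A, f x = 1) ∧
      (∀ x, (∀ a ∈ A, r ≤ dist x a) → f x = 0) ∧
      ∀ k x, ‖iteratedFDeriv ℝ k f x‖ ≤ C k * (r⁻¹) ^ k := by
  obtain ⟨C, hC0, hC⟩ := cutoff_unit n
  refine ⟨C, hC0, fun A r hr => ?_⟩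
  obtain ⟨f, hf, h1, h0, hk⟩ := hC ((fun x => r⁻¹ • x) '' A)
  refine ⟨fun x => f (r⁻¹ • x), hf.comp (contDiff_id.const_smul _), ?_, ?_, ?_⟩
  · intro x hx
    exact h1 _ ⟨x, hx, rfl⟩
  · intro x hx
    refine h0 _ ?_
    rintro _ ⟨a, ha, rfl⟩
    simp only
    rw [dist_smul₀, Real.norm_eq_abs, abs_of_pos (inv_pos.2 hr), ← div_eq_inv_mul, le_div_iff₀ hr]
    simpa using hx a ha
  · intro k x
    rw [iteratedFDeriv_comp_const_smul r⁻¹ (hf.of_le (by exact_mod_cast le_top)), norm_smul, norm_pow, Real.norm_eq_abs,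
      abs_of_pos (inv_pos.2 hr), mul_comm]
    exact mul_le_mul_of_nonneg_right (hk k _) (by positivity)

end SemiAlg
end

section
open Polynomial Filter Topology
namespace SemiAlg

/-- The compact exhaustion of `U`. -/
def KK {n : ℕ} (U : Set (Fin n → ℝ)) (s : ℝ) : Set (Fin n → ℝ) :=
  {x | s * ‖x‖ ≤ 1 ∧ ∀ z ∉ U, s ≤ dist x z}

theorem flat_bound {n : ℕ} (U : Set (Fin n → ℝ)) (φ : SchwartzMap (Fin n → ℝ) ℝ)
    (hφ : ∀ z ∉ U, SmoothFlatAt (⇑φ) z) (L : ℕ) : ∀ k : ℕ, ∃ C : ℝ, 0 ≤ C ∧ ∀ z ∉ U, ∀ x,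
      ‖iteratedFDeriv ℝ k φ x‖ ≤ C * dist x z ^ L := by
  induction L with
  | zero =>
    intro k
    obtain ⟨C, hC0, hC⟩ := φ.decay 0 k
    exact ⟨C, hC0.le, fun z _ x => by simpa using hC x⟩
  | succ L ih =>
    intro k
    obtain ⟨C, hC0, hC⟩ := ih (k + 1)
    refine ⟨C, hC0, fun z hz x => ?_⟩
    have h := (convex_closedBall z (dist x z)).norm_image_sub_le_of_norm_fderiv_le (𝕜 := ℝ)
      (f := iteratedFDeriv ℝ k φ) (C := C * dist x z ^ L) (x := z) (y := x)
      (fun y _ => (φ.smooth'.differentiable_iteratedFDeriv (m := k) (by exact_mod_cast WithTop.coe_lt_top k)) y)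
      (fun y hy => by
        rw [norm_fderiv_iteratedFDeriv]
        refine (hC z hz y).trans ?_
        exact mul_le_mul_of_nonneg_left (pow_le_pow_left₀ dist_nonneg (Metric.mem_closedBall.1 hy) _) hC0)
      (Metric.mem_closedBall_self dist_nonneg) (Metric.mem_closedBall.2 le_rfl)
    rw [hφ z hz k, sub_zero, ← dist_eq_norm] at h
    rw [pow_succ, ← mul_assoc]
    exact h

theorem off_bound {n : ℕ} (U : Set (Fin n → ℝ)) (φ : SchwartzMap (Fin n → ℝ) ℝ)
    (hφ : ∀ z ∉ U, SmoothFlatAt (⇑φ) z) (k l L : ℕ) : ∃ C : ℝ, 0 ≤ C ∧ ∀ t : ℝ, 0 < t →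
      ∀ x ∉ KK U t, ‖x‖ ^ l * ‖iteratedFDeriv ℝ k φ x‖ ≤ C * t ^ L := by
  obtain ⟨C1, hC10, hC1⟩ := φ.decay (l + L) k
  obtain ⟨C2, hC20, hC2⟩ := φ.decay (l + l) k
  obtain ⟨C3, hC30, hC3⟩ := flat_bound U φ hφ (L + L) k
  have hp : 0 ≤ C2 * C3 := by positivity
  refine ⟨C1 + 1 + C2 * C3, by positivity, fun t ht x hx => ?_⟩
  have htL : 0 < t ^ L := pow_pos ht L
  set D := ‖iteratedFDeriv ℝ k φ x‖ with hD
  have hD0 : 0 ≤ D := norm_nonneg _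
  have hx0 : 0 ≤ ‖x‖ ^ l := by positivity
  by_cases h1 : t * ‖x‖ ≤ 1
  · have : ∃ z ∉ U, dist x z < t := by
      by_contra hcon
      push Not at hcon
      exact hx ⟨h1, hcon⟩
    obtain ⟨z, hz, hxz⟩ := this
    have hb : D ≤ C3 * (t ^ L) ^ 2 := by
      refine (hC3 z hz x).trans (mul_le_mul_of_nonneg_left ?_ hC30)
      rw [← pow_mul, mul_two]
      exact pow_le_pow_left₀ dist_nonneg hxz.le _
    have ha := hC2 x
    rw [pow_add] at ha
    refine le_trans (b := (1 + C2 * C3) * t ^ L) ?_ (by nlinarith)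
    refine (le_abs_self _).trans (abs_le_of_sq_le_sq ?_ (by positivity))
    calc (‖x‖ ^ l * D) ^ 2 = (‖x‖ ^ l * ‖x‖ ^ l * D) * D := by ring
      _ ≤ C2 * (C3 * (t ^ L) ^ 2) := mul_le_mul ha hb hD0 hC20.le
      _ ≤ ((1 + C2 * C3) * t ^ L) ^ 2 := by
        have : 0 ≤ (t ^ L) ^ 2 := by positivity
        nlinarith [mul_nonneg this (by nlinarith : 0 ≤ 1 + C2 * C3 + (C2 * C3) ^ 2)]
  · push Not at h1
    have h2 : 1 ≤ (t * ‖x‖) ^ L := one_le_pow₀ h1.le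
    have ha := hC1 x
    calc ‖x‖ ^ l * D ≤ ‖x‖ ^ l * D * (t * ‖x‖) ^ L := le_mul_of_one_le_right (by positivity) h2
      _ = (‖x‖ ^ (l + L) * D) * t ^ L := by rw [mul_pow, pow_add]; ring
      _ ≤ C1 * t ^ L := mul_le_mul_of_nonneg_right ha htL.le
      _ ≤ _ := by nlinarith

theorem KK_anti {n : ℕ} {U : Set (Fin n → ℝ)} {s t : ℝ} (h : s ≤ t) : KK U t ⊆ KK U s :=
  fun x hx => ⟨(mul_le_mul_of_nonneg_right h (norm_nonneg x)).trans hx.1,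
    fun z hz => h.trans (hx.2 z hz)⟩

theorem KK_thick {n : ℕ} {U : Set (Fin n → ℝ)} {s : ℝ} (h0 : 0 < s) (h : s ≤ 1 / 2)
    {a x : Fin n → ℝ} (ha : a ∈ KK U (2 * s)) (hx : dist x a ≤ s) : x ∈ KK U s := by
  constructor
  · have h1 := ha.1
    have h2 : ‖x‖ ≤ ‖a‖ + s := by
      have := norm_le_norm_add_norm_sub' x a
      rw [dist_eq_norm] at hx
      linarith
    nlinarith
  · intro z hz
    have := ha.2 z hz
    have h3 := dist_triangle_left a z x
    linarith

open ContDiff in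
theorem mul_bound {n : ℕ} {f g : (Fin n → ℝ) → ℝ} (hf : ContDiff ℝ ∞ f) (hg : ContDiff ℝ ∞ g)
    (A B : ℕ → ℝ) (R c : ℝ) (x : Fin n → ℝ) (k : ℕ) (hc : 0 ≤ c)
    (hA : ∀ i ≤ k, c * ‖iteratedFDeriv ℝ i f x‖ ≤ A i * R ^ i)
    (hB : ∀ i ≤ k, ‖iteratedFDeriv ℝ i g x‖ ≤ B i * R ^ i) :
    c * ‖iteratedFDeriv ℝ k (fun y => f y * g y) x‖ ≤
      (∑ i ∈ Finset.range (k + 1), (k.choose i : ℝ) * A i * B (k - i)) * R ^ k := by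
  refine (mul_le_mul_of_nonneg_left (norm_iteratedFDeriv_mul_le (N := ∞) hf hg x (n := k) (by exact_mod_cast le_top)) hc).trans ?_
  rw [Finset.mul_sum, Finset.sum_mul]
  refine Finset.sum_le_sum fun i hi => ?_
  have hik : i ≤ k := Nat.lt_succ_iff.1 (Finset.mem_range.1 hi)
  have h1 := hA i hik
  have h2 := hB (k - i) (Nat.sub_le _ _)
  have h3 := mul_le_mul h1 h2 (norm_nonneg _) (le_trans (by positivity) h1)
  have h4 := mul_le_mul_of_nonneg_left h3 (Nat.cast_nonneg (α := ℝ) (k.choose i))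
  have hpow : R ^ k = R ^ i * R ^ (k - i) := by rw [← pow_add, Nat.add_sub_cancel' hik]
  rw [hpow]
  linarith

open ContDiff in
theorem schwartz_sum {n : ℕ} (T : ℕ → (Fin n → ℝ) → ℝ) (hT : ∀ j, ContDiff ℝ ∞ (T j))
    (hb : ∀ k l : ℕ, ∃ C : ℝ, ∀ j x, ‖x‖ ^ l * ‖iteratedFDeriv ℝ k (T j) x‖ ≤ C * (1 / 2) ^ j) :
    ∃ ψ : SchwartzMap (Fin n → ℝ) ℝ, (∀ x, HasSum (fun j => T j x) (ψ x)) ∧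
      ∀ z, (∀ j k, iteratedFDeriv ℝ k (T j) z = 0) → SmoothFlatAt (⇑ψ) z := by
  choose C hC using hb
  have hs : ∀ k l, Summable fun j : ℕ => C k l * (1 / 2 : ℝ) ^ j := fun k l =>
    summable_geometric_two.mul_left _
  have hb0 : ∀ (k : ℕ) (j : ℕ) (x : Fin n → ℝ), (k : ℕ∞) ≤ ⊤ →
      ‖iteratedFDeriv ℝ k (T j) x‖ ≤ C k 0 * (1 / 2 : ℝ) ^ j := fun k j x _ => by
    simpa using hC k 0 j x
  have hsm := contDiff_tsum (N := ⊤) hT (fun k _ => hs k 0) hb0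
  have hder : ∀ (k : ℕ) x, iteratedFDeriv ℝ k (fun y => ∑' j, T j y) x
      = ∑' j, iteratedFDeriv ℝ k (T j) x := fun k x =>
    iteratedFDeriv_tsum_apply (N := ⊤) hT (fun k _ => hs k 0) hb0 le_top x
  refine ⟨⟨fun y => ∑' j, T j y, hsm, fun l k => ⟨∑' j, C k l * (1 / 2 : ℝ) ^ j, fun x => ?_⟩⟩, ?_, ?_⟩
  · rw [hder]
    have hsn : Summable fun j => ‖iteratedFDeriv ℝ k (T j) x‖ :=
      Summable.of_nonneg_of_le (fun _ => norm_nonneg _) (fun j => hb0 k j x le_top) (hs k 0)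
    calc _ ≤ ‖x‖ ^ l * ∑' j, ‖iteratedFDeriv ℝ k (T j) x‖ :=
          mul_le_mul_of_nonneg_left (norm_tsum_le_tsum_norm hsn) (by positivity)
      _ = ∑' j, ‖x‖ ^ l * ‖iteratedFDeriv ℝ k (T j) x‖ := tsum_mul_left.symm
      _ ≤ _ := (hsn.mul_left _).tsum_le_tsum (fun j => hC k l j x) (hs k l)
  · intro x
    refine Summable.hasSum (Summable.of_norm_bounded (hs 0 0) fun j => ?_)
    simpa using hb0 0 j x le_top
  · intro z hz k
    refine (hder k z).trans ?_
    simp [hz]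

end SemiAlg
end

section
open Polynomial Filter Topology
namespace SemiAlg

open ContDiff in
theorem extend_main {n : ℕ} (X U V : Set (Fin n → ℝ)) (hUo : IsOpen U) (hXU : X ⊆ U)
    (φ : SchwartzMap (Fin n → ℝ) ℝ) (hφ : ∀ z ∉ U, SmoothFlatAt (⇑φ) z)
    (N : ℕ) (hN : 1 ≤ N) (σ : ℝ) (hσ0 : 0 < σ) (hσ : σ ≤ 1 / 2)
    (hl : ∀ s, 0 < s → s ≤ σ → ∀ x ∈ X, x ∈ KK U s → ∀ y ∉ V, s ^ N ≤ dist x y) :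
    ∃ ψ : SchwartzMap (Fin n → ℝ) ℝ, (∀ z ∉ V, SmoothFlatAt (⇑ψ) z) ∧ ∀ x ∈ X, ψ x = φ x := by
  obtain ⟨C, hC0, hC⟩ := cutoff n
  set s : ℕ → ℝ := fun j => σ * (1 / 2) ^ j with hs
  have hs0 : ∀ j, 0 < s j := fun j => by positivity
  have hs1 : ∀ j, s (j + 1) = s j / 2 := fun j => by simp only [hs, pow_succ]; ring
  have hsσ : ∀ j, s j ≤ σ := fun j =>
    mul_le_of_le_one_right hσ0.le (pow_le_one₀ (by norm_num) (by norm_num))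
  set ρ : ℕ → ℝ := fun j => s (j + 1) ^ N / 2 with hρ
  have hρ0 : ∀ j, 0 < ρ j := fun j => by have := hs0 (j + 1); positivity
  have hρs : ∀ j, ρ j ≤ s (j + 1) := fun j => by
    have h1 := hs0 (j + 1)
    have h2 : s (j + 1) ≤ 1 := (hsσ _).trans (by linarith)
    have h3 : s (j + 1) ^ N ≤ s (j + 1) := pow_le_of_le_one h1.le h2 (by omega)
    simp only [hρ]
    linarith
  choose u hu huone huzero hub using fun j => hC (KK U (s j)) (s (j + 1)) (hs0 _)
  choose h hh hhone hhzero hhb using fun j => hC (X ∩ KK U (s (j + 1))) (ρ j) (hρ0 _)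
  have hKsub : ∀ j, KK U (s j) ⊆ KK U (s (j + 1)) := fun j =>
    KK_anti (by rw [hs1]; linarith [hs0 j])
  have hu0 : ∀ j, ∀ x ∉ KK U (s (j + 1)), u j x = 0 := by
    intro j x hx
    refine huzero j x fun a ha => ?_
    by_contra hlt
    push Not at hlt
    refine hx (KK_thick (hs0 _) ((hsσ _).trans hσ) (a := a) ?_ hlt.le)
    rw [hs1]
    convert ha using 2
    ring
  set v : ℕ → (Fin n → ℝ) → ℝ := fun j => Nat.casesOn j (u 0) (fun i => fun x => u (i + 1) x - u i x) with hv
  have hv0 : v 0 = u 0 := rfl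
  have hvs : ∀ j, v (j + 1) = fun x => u (j + 1) x - u j x := fun j => rfl
  have hvsm : ∀ j, ContDiff ℝ ∞ (v j) := by
    rintro (_ | j)
    · exact hu 0
    · exact (hu _).sub (hu _)
  have hvz : ∀ j, ∀ x ∉ KK U (s (j + 1)), v j x = 0 := by
    rintro (_ | j) x hx
    · exact hu0 0 x hx
    · rw [hvs]
      simp only
      rw [hu0 (j + 1) x hx, hu0 j x (fun h' => hx (hKsub _ h')), sub_zero]
  have hvb : ∀ j k x, ‖iteratedFDeriv ℝ k (v j) x‖ ≤ (2 * C k) * ((ρ j)⁻¹) ^ k := by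
    have aux : ∀ j k, C k * ((s (j + 1))⁻¹) ^ k ≤ C k * ((ρ j)⁻¹) ^ k := fun j k => by
      refine mul_le_mul_of_nonneg_left (pow_le_pow_left₀ (inv_nonneg.2 (hs0 _).le) ?_ _) (hC0 k)
      exact inv_anti₀ (hρ0 j) (hρs j)
    have aux0 : ∀ j k, 0 ≤ C k * ((ρ j)⁻¹) ^ k := fun j k =>
      mul_nonneg (hC0 k) (pow_nonneg (inv_nonneg.2 (hρ0 j).le) _)
    rintro (_ | j) k x
    · have := (hub 0 k x).trans (aux 0 k)
      have h2 := aux0 0 k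
      rw [hv0]
      linarith
    · rw [hvs]
      have h1 := (hub (j + 1) k x).trans (aux (j + 1) k)
      have h2 : C k * ((s (j + 1))⁻¹) ^ k ≤ C k * ((s (j + 1 + 1))⁻¹) ^ k := by
        refine mul_le_mul_of_nonneg_left (pow_le_pow_left₀ (inv_nonneg.2 (hs0 _).le) ?_ _) (hC0 k)
        refine inv_anti₀ (hs0 _) ?_
        rw [hs1 (j + 1)]; linarith [hs0 (j + 1)]
      have h3 := ((hub j k x).trans h2).trans (aux (j + 1) k)
      have h4 : iteratedFDeriv ℝ k (fun x => u (j + 1) x - u j x) x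
          = iteratedFDeriv ℝ k (u (j + 1)) x - iteratedFDeriv ℝ k (u j) x :=
        iteratedFDeriv_sub_apply ((hu _).of_le (by exact_mod_cast le_top)).contDiffAt
          ((hu _).of_le (by exact_mod_cast le_top)).contDiffAt
      rw [h4]
      refine (norm_sub_le _ _).trans ?_
      linarith
  have hvev : ∀ j, ∀ x ∈ KK U (4 * s (j + 1)), v (j + 1) =ᶠ[𝓝 x] 0 := by
    intro j x hx
    filter_upwards [Metric.closedBall_mem_nhds x (hs0 j)] with y hy
    have hyK : y ∈ KK U (s j) := KK_thick (hs0 j) ((hsσ _).trans hσ) (a := x)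
      (by convert hx using 2; rw [hs1]; ring) hy
    rw [hvs]
    simp [huone (j + 1) y (hKsub _ hyK), huone j y hyK]
  set w : ℕ → (Fin n → ℝ) → ℝ := fun j x => h j x * v j x with hw
  have hwsm : ∀ j, ContDiff ℝ ∞ (w j) := fun j => (hh j).mul (hvsm j)
  set G : ℕ → ℝ := fun k => ∑ i ∈ Finset.range (k + 1), (k.choose i : ℝ) * C i * (2 * C (k - i)) with hG
  have hG0 : ∀ k, 0 ≤ G k := fun k => Finset.sum_nonneg fun i _ => by
    have := hC0 i; have := hC0 (k - i); positivity
  have hwb : ∀ j k x, ‖iteratedFDeriv ℝ k (w j) x‖ ≤ G k * ((ρ j)⁻¹) ^ k := fun j k x => by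
    have := mul_bound (hh j) (hvsm j) C (fun k => 2 * C k) ((ρ j)⁻¹) 1 x k zero_le_one
      (fun i _ => by simpa using hhb j i x) (fun i _ => hvb j i x)
    simpa using this
  have hR1 : ∀ j, 1 ≤ (ρ j)⁻¹ := fun j =>
    (one_le_inv₀ (hρ0 j)).2 ((hρs j).trans ((hsσ _).trans (by linarith)))
  obtain ⟨ψ, hψ, hflat⟩ := schwartz_sum (fun j x => φ x * w j x) (fun j => φ.smooth'.mul (hwsm j)) (by
    intro k l
    choose Co hCo0 hCo using fun i => off_bound U φ hφ i l (N * k + 1)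
    choose Cd hCd0 hCd using fun i => φ.decay l i
    set B : ℕ → ℝ := fun i => Co i + Cd i with hB
    have hB0 : ∀ i, 0 ≤ B i := fun i => add_nonneg (hCo0 i) (hCd0 i).le
    set M : ℝ := ∑ i ∈ Finset.range (k + 1), (k.choose i : ℝ) * B i * G (k - i) with hM
    have hM0 : 0 ≤ M := Finset.sum_nonneg fun i _ => by
      have := hB0 i; have := hG0 (k - i); positivity
    have key : ∀ j x τ, 0 ≤ τ → (∀ i, ‖x‖ ^ l * ‖iteratedFDeriv ℝ i φ x‖ ≤ B i * τ) →
        ‖x‖ ^ l * ‖iteratedFDeriv ℝ k (fun x => φ x * w j x) x‖ ≤ M * (τ * ((ρ j)⁻¹) ^ k) := by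
      intro j x τ hτ hx
      have := mul_bound φ.smooth' (hwsm j) (fun i => B i * τ) G ((ρ j)⁻¹) (‖x‖ ^ l) x k (by positivity)
        (fun i _ => (hx i).trans (le_mul_of_one_le_right (mul_nonneg (hB0 i) hτ) (one_le_pow₀ (hR1 j))))
        (fun i _ => hwb j i x)
      refine this.trans (le_of_eq ?_)
      rw [← mul_assoc, hM, Finset.sum_mul (a := τ)]
      congr 1
      refine Finset.sum_congr rfl fun i _ => ?_
      ring
    set P : ℝ := 4 ^ (N * k + 1) * (2 ^ (N + 1)) ^ k with hP
    have hP0 : 0 ≤ P := by positivity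
    have hQ0 : 0 ≤ ((ρ 0)⁻¹) ^ k := by have := hR1 0; positivity
    refine ⟨M * (P + ((ρ 0)⁻¹) ^ k), fun j x => ?_⟩
    rcases j with _ | j
    · refine (key 0 x 1 zero_le_one (fun i => ?_)).trans ?_
      · rw [mul_one]
        exact (hCd i x).trans (by simp only [hB]; linarith [hCo0 i])
      · rw [pow_zero, mul_one, one_mul]
        exact mul_le_mul_of_nonneg_left (by linarith) hM0
    · by_cases hx : x ∈ KK U (4 * s (j + 1))
      · have hz : (fun x => φ x * w (j + 1) x) =ᶠ[𝓝 x] 0 := by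
          filter_upwards [hvev j x hx] with y hy
          simp [hw, hy]
        have : iteratedFDeriv ℝ k (fun x => φ x * w (j + 1) x) x = 0 := by
          rw [(hz.iteratedFDeriv ℝ k).eq_of_nhds]
          exact congrFun iteratedFDeriv_fun_zero x
        rw [this, norm_zero, mul_zero]
        positivity
      · have hsj := hs0 (j + 1)
        refine (key (j + 1) x ((4 * s (j + 1)) ^ (N * k + 1)) (by positivity) (fun i => ?_)).trans ?_
        · refine (hCo i _ (by positivity) x hx).trans (mul_le_mul_of_nonneg_right ?_ (by positivity))
          simp only [hB]; linarith [hCd0 i]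
        · rw [mul_assoc]
          refine mul_le_mul_of_nonneg_left ?_ hM0
          have e1 : (4 * s (j + 1)) ^ (N * k + 1) * ((ρ (j + 1))⁻¹) ^ k = P * s (j + 1) := by
            simp only [hρ, hP]
            rw [hs1 (j + 1)]
            generalize s (j + 1) = t at hsj
            have e0 : ((t / 2) ^ N / 2)⁻¹ = 2 ^ (N + 1) / t ^ N := by
              rw [div_pow, pow_succ]
              field_simp
            rw [e0, div_pow, mul_pow, ← pow_mul t N k, pow_succ t (N * k)]
            field_simp
          rw [e1, add_mul]
          have e2 : s (j + 1) ≤ (1 / 2) ^ (j + 1) :=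
            mul_le_of_le_one_left (by positivity) (by linarith)
          have e3 := mul_le_mul_of_nonneg_left e2 hP0
          have e4 : 0 ≤ ((ρ 0)⁻¹) ^ k * (1 / 2) ^ (j + 1) := by positivity
          linarith)
  refine ⟨ψ, fun z hz => hflat z fun j k => ?_, fun x hx => ?_⟩
  · have hz' : (fun x => φ x * w j x) =ᶠ[𝓝 z] 0 := by
      filter_upwards [Metric.ball_mem_nhds z (hρ0 j)] with y hy
      have : h j y = 0 := by
        refine hhzero j y fun a ha => ?_
        have h1 := hl _ (hs0 (j + 1)) (hsσ _) a ha.1 ha.2 z hz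
        have h2 : s (j + 1) ^ N = 2 * ρ j := by simp only [hρ]; ring
        have h3 := dist_triangle_left a z y
        rw [Metric.mem_ball] at hy
        linarith
      simp [hw, this]
    rw [(hz'.iteratedFDeriv ℝ k).eq_of_nhds]
    exact congrFun iteratedFDeriv_fun_zero z
  · have hwv : ∀ j, w j x = v j x := by
      intro j
      by_cases hxK : x ∈ KK U (s (j + 1))
      · simp [hw, hhone j x ⟨hx, hxK⟩]
      · simp [hw, hvz j x hxK]
    have htel : ∀ J, ∑ j ∈ Finset.range (J + 1), φ x * w j x = φ x * u J x := by
      intro J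
      rw [← Finset.mul_sum]
      congr 1
      induction J with
      | zero => simp [hwv, hv0]
      | succ J ih => rw [Finset.sum_range_succ, ih, hwv, hvs]; ring
    obtain ⟨ε, hε, hball⟩ := Metric.isOpen_iff.1 hUo x (hXU hx)
    have hst : Tendsto s atTop (𝓝 0) := by
      have := (tendsto_pow_atTop_nhds_zero_of_lt_one (r := (1 / 2 : ℝ)) (by norm_num) (by norm_num)).const_mul σ
      simpa [hs] using this
    have hst2 : Tendsto (fun j => s j * ‖x‖) atTop (𝓝 0) := by simpa using hst.mul_const ‖x‖
    have hev : ∀ᶠ J in atTop, u J x = 1 := by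
      filter_upwards [hst.eventually_lt_const hε, hst2.eventually_lt_const one_pos] with J h1 h2
      refine huone J x ⟨h2.le, fun z hz => ?_⟩
      by_contra hlt
      push Not at hlt
      exact hz (hball (by rw [Metric.mem_ball, dist_comm]; linarith))
    have ht := ((hψ x).tendsto_sum_nat).comp (tendsto_add_atTop_nat 1)
    refine tendsto_nhds_unique ht ?_
    refine Tendsto.congr' ?_ tendsto_const_nhds
    filter_upwards [hev] with J hJ
    simp only [Function.comp_apply]
    rw [htel, hJ, mul_one]

theorem rel_subset {n : ℕ} (X U V : Set (Fin n → ℝ))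
    (hXsa : IsSemialgebraic X)
    (hUo : IsOpen U) (hUsa : IsSemialgebraic U)
    (hVo : IsOpen V) (hVsa : IsSemialgebraic V)
    (hXU : X ⊆ U) (hXV : X ⊆ V)
    (hXclU : IsClosed ((Subtype.val ⁻¹' X : Set ↥U))) :
    SchwartzRelOpen U X ⊆ SchwartzRelOpen V X := by
  rintro f ⟨φ, hφ, hf⟩
  obtain ⟨N, hN⟩ := loja X U V hXsa hUsa hVo hVsa hXU hXV hXclU
  obtain ⟨σ, hσ0, hσ⟩ := (mem_nhdsGT_iff_exists_Ioc_subset).1 hN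
  have hσ0' : (0 : ℝ) < σ := hσ0
  obtain ⟨ψ, hψ, hψφ⟩ := extend_main X U V hUo hXU φ (fun z hz => hφ z hz) (N + 1) (by omega)
    (min σ (1 / 2)) (lt_min hσ0' (by norm_num)) (min_le_right _ _) (by
      intro s hs0 hs x hx hxK y hy
      have h1 := hσ ⟨hs0, hs.trans (min_le_left _ _)⟩ x hx hxK.1 hxK.2 y hy
      refine le_trans ?_ h1
      exact pow_le_pow_of_le_one hs0.le ((hs.trans (min_le_right _ _)).trans (by norm_num)) (by omega))
  exact ⟨ψ, fun z hz => hψ z hz, fun x => by rw [hf x, hψφ x x.2]⟩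

end SemiAlg
end

/-- The space of Schwartz functions on a semialgebraic set `X` does not depend on the
open semialgebraic set in which `X` sits as a closed subset. -/
theorem stmt_7 {n : ℕ} (X U V : Set (Fin n → ℝ))
    (hXsa : IsSemialgebraic X)
    (hUo : IsOpen U) (hUsa : IsSemialgebraic U)
    (hVo : IsOpen V) (hVsa : IsSemialgebraic V)
    (hXU : X ⊆ U) (hXV : X ⊆ V)
    (hXclU : IsClosed ((Subtype.val ⁻¹' X : Set ↥U)))
    (hXclV : IsClosed ((Subtype.val ⁻¹' X : Set ↥V))) :
    SchwartzRelOpen U X = SchwartzRelOpen V X := by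
  exact Set.Subset.antisymm
    (SemiAlg.rel_subset X U V hXsa hUo hUsa hVo hVsa hXU hXV hXclU)
    (SemiAlg.rel_subset X V U hXsa hVo hVsa hUo hUsa hXV hXU hXclV)
end

section
/- Let X ⊆ ℝ^n and Y ⊆ ℝ^m be locally closed semialgebraic sets and let φ : X → Y be a continuous map. Then φ is an NQN morphism (i.e. there exist an open semialgebraic U ⊆ ℝ^n with X ⊆ U closed in U and a Nash map g : U → ℝ^m with g|_X = φ) if and only if for every NQN function f : Y → ℝ, the composition f ∘ φ : X → ℝ is an NQN function. -/
/-- A Nash map on an open semialgebraic set `U ⊆ ℝⁿ` is a `C^∞` map `g : U → ℝ^m`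
whose graph is a semialgebraic subset of `ℝ^{n+m}`. -/
def IsNashMap {n m : ℕ} (U : Set (Fin n → ℝ)) (g : (Fin n → ℝ) → (Fin m → ℝ)) : Prop :=
  ContDiffOn ℝ (⊤ : ℕ∞) g U ∧
    IsSemialgebraic {p : Fin (n + m) → ℝ |
      (fun i => p (Fin.castAdd m i)) ∈ U ∧
      ∀ j, g (fun i => p (Fin.castAdd m i)) j = p (Fin.natAdd n j)}

/-- A Nash function on an open semialgebraic set `U ⊆ ℝⁿ` is a `C^∞` function
`g : U → ℝ` whose graph is a semialgebraic subset of `ℝ^{n+1}`. -/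
def IsNashFun {n : ℕ} (U : Set (Fin n → ℝ)) (g : (Fin n → ℝ) → ℝ) : Prop :=
  ContDiffOn ℝ (⊤ : ℕ∞) g U ∧
    IsSemialgebraic {p : Fin (n + 1) → ℝ |
      (fun i => p (Fin.castAdd 1 i)) ∈ U ∧
      g (fun i => p (Fin.castAdd 1 i)) = p (Fin.natAdd n 0)}

/-- An NQN map `h : X → ℝ^m` on a locally closed semialgebraic `X ⊆ ℝⁿ`: `h` (whose
values matter only on `X`) is the restriction to `X` of a Nash map on an open
semialgebraic set `U ⊇ X` in which `X` is closed. -/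
def IsNQNMap {n m : ℕ} (X : Set (Fin n → ℝ)) (h : (Fin n → ℝ) → (Fin m → ℝ)) : Prop :=
  ∃ U : Set (Fin n → ℝ), IsOpen U ∧ IsSemialgebraic U ∧ X ⊆ U ∧
    IsClosed ((Subtype.val ⁻¹' X : Set ↥U)) ∧
    ∃ g : (Fin n → ℝ) → (Fin m → ℝ), IsNashMap U g ∧ ∀ x ∈ X, g x = h x

/-- An NQN function on `X`: the restriction to `X` of a Nash function on an open
semialgebraic set `U ⊇ X` in which `X` is closed. -/
def IsNQNFun {n : ℕ} (X : Set (Fin n → ℝ)) (h : (Fin n → ℝ) → ℝ) : Prop :=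
  ∃ U : Set (Fin n → ℝ), IsOpen U ∧ IsSemialgebraic U ∧ X ⊆ U ∧
    IsClosed ((Subtype.val ⁻¹' X : Set ↥U)) ∧
    ∃ g : (Fin n → ℝ) → ℝ, IsNashFun U g ∧ ∀ x ∈ X, g x = h x

theorem ts_bump_aux (a b u v : ℝ) (hau : a < u) (huv : u ≤ v) (hvb : v < b) :
    ∃ ψ : ℝ ≃o ℝ, ψ u = v ∧ ∀ t, t ∉ Set.Ioo a b → ψ t = t := by
  have h1 : 0 < (v - a) / (u - a) := div_pos (by linarith) (by linarith)
  have h2 : 0 < (b - v) / (b - u) := div_pos (by linarith) (by linarith)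
  have h1' : 1 ≤ (v - a) / (u - a) := by
    rw [le_div_iff₀ (by linarith)]; linarith
  have h2' : (b - v) / (b - u) ≤ 1 := by
    rw [div_le_iff₀ (by linarith)]; linarith
  have e1 : (v - a) / (u - a) * (u - a) = v - a := div_mul_cancel₀ _ (by linarith)
  have e2 : (b - v) / (b - u) * (b - u) = b - v := div_mul_cancel₀ _ (by linarith)
  generalize (v - a) / (u - a) = k at *
  generalize (b - v) / (b - u) = l at *
  let F : ℝ → ℝ := fun t => max t (min (a + k * (t - a)) (b - l * (b - t)))
  have hmono : StrictMono F := by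
    have m1 : StrictMono (fun t : ℝ => a + k * (t - a)) := by
      intro s t h; simp only; nlinarith
    have m2 : StrictMono (fun t : ℝ => b - l * (b - t)) := by
      intro s t h; simp only; nlinarith
    exact fun s t h => max_lt_max h (min_lt_min (m1 h) (m2 h))
  have hout : ∀ t, t ∉ Set.Ioo a b → F t = t := by
    intro t ht
    simp only [F]
    apply max_eq_left
    by_cases hat : a < t
    · have hbt : b ≤ t := by
        by_contra h
        exact ht ⟨hat, by linarith⟩
      apply (min_le_right _ _).trans
      nlinarith
    · apply (min_le_left _ _).trans
      nlinarith
  have hcont : Continuous F := by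
    simp only [F]; fun_prop
  have hsurj : Function.Surjective F := by
    intro y
    by_cases hy : y ∈ Set.Ioo a b
    · have := intermediate_value_Icc (show a ≤ b by linarith) hcont.continuousOn
      rw [hout a (by simp), hout b (by simp)] at this
      obtain ⟨t, -, ht⟩ := this ⟨hy.1.le, hy.2.le⟩
      exact ⟨t, ht⟩
    · exact ⟨y, hout y hy⟩
  refine ⟨hmono.orderIsoOfSurjective F hsurj, ?_, ?_⟩
  · simp only [StrictMono.coe_orderIsoOfSurjective, F]
    rw [e1, e2]
    simp [huv]
  · intro t ht
    simpa only [StrictMono.coe_orderIsoOfSurjective] using hout t ht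

theorem ts_bump (a b u v : ℝ) (hu : u ∈ Set.Ioo a b) (hv : v ∈ Set.Ioo a b) :
    ∃ ψ : ℝ ≃o ℝ, ψ u = v ∧ ∀ t, t ∉ Set.Ioo a b → ψ t = t := by
  rcases le_total u v with h | h
  · exact ts_bump_aux a b u v hu.1 h hv.2
  · obtain ⟨ψ, h1, h2⟩ := ts_bump_aux a b v u hv.1 h hu.2
    refine ⟨ψ.symm, ?_, ?_⟩
    · rw [← h1]; simp
    · intro t ht
      conv_lhs => rw [← h2 t ht]
      simp

/-- gap lemma: existence of zeros transfers -/
theorem ts_gap_zero (f h : ℝ → ℝ) (hh : Continuous h) (a b w : ℝ)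
    (hw : w ∈ Set.Ioo a b) (hfw : f w = 0)
    (sa : SignType.sign (f a) = SignType.sign (h a))
    (sb : SignType.sign (f b) = SignType.sign (h b))
    (mf : StrictMonoOn f (Set.Icc a b)) :
    ∃ s ∈ Set.Ioo a b, h s = 0 := by
  have hab : a < b := hw.1.trans hw.2
  have ha : f a < 0 := by
    rw [← hfw]; exact mf ⟨le_rfl, hab.le⟩ ⟨hw.1.le, hw.2.le⟩ hw.1
  have hb : 0 < f b := by
    rw [← hfw]; exact mf ⟨hw.1.le, hw.2.le⟩ ⟨hab.le, le_rfl⟩ hw.2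
  rw [sign_neg ha, eq_comm, sign_eq_neg_one_iff] at sa
  rw [sign_pos hb, eq_comm, sign_eq_one_iff] at sb
  exact intermediate_value_Ioo hab.le hh.continuousOn ⟨sa, sb⟩

theorem ts_gap_sign (f h : ℝ → ℝ) (hf : Continuous f) (a b t t' : ℝ) (ψ : ℝ ≃o ℝ)
    (ht : t ∈ Set.Ioo a b) (ht' : t' = ψ t) (ha : ψ a = a) (hb : ψ b = b)
    (hz : ∀ w ∈ Set.Ioo a b, f w = 0 → h (ψ w) = 0)
    (sa : SignType.sign (f a) = SignType.sign (h a))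
    (sb : SignType.sign (f b) = SignType.sign (h b))
    (mf : StrictMonoOn f (Set.Icc a b)) (mh : StrictMonoOn h (Set.Icc a b)) :
    SignType.sign (f t) = SignType.sign (h t') := by
  have hab : a < b := ht.1.trans ht.2
  have hmem : ∀ s ∈ Set.Ioo a b, ψ s ∈ Set.Ioo a b := by
    intro s hs
    constructor
    · rw [← ha]; exact ψ.strictMono hs.1
    · rw [← hb]; exact ψ.strictMono hs.2
  have iA : a ∈ Set.Icc a b := ⟨le_rfl, hab.le⟩
  have iB : b ∈ Set.Icc a b := ⟨hab.le, le_rfl⟩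
  have sub : ∀ s ∈ Set.Ioo a b, s ∈ Set.Icc a b := fun s hs => ⟨hs.1.le, hs.2.le⟩
  subst ht'
  by_cases hw : ∃ w ∈ Set.Ioo a b, f w = 0
  · obtain ⟨w, hw, hfw⟩ := hw
    have hhw := hz w hw hfw
    rcases lt_trichotomy t w with h1 | h1 | h1
    · have e1 := mf (sub _ ht) (sub _ hw) h1
      have e2 := mh (sub _ (hmem _ ht)) (sub _ (hmem _ hw)) (ψ.strictMono h1)
      rw [hfw] at e1; rw [hhw] at e2
      rw [sign_neg e1, sign_neg e2]
    · subst h1; rw [hfw, hhw]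
    · have e1 := mf (sub _ hw) (sub _ ht) h1
      have e2 := mh (sub _ (hmem _ hw)) (sub _ (hmem _ ht)) (ψ.strictMono h1)
      rw [hfw] at e1; rw [hhw] at e2
      rw [sign_pos e1, sign_pos e2]
  · have e1 := mf iA (sub _ ht) ht.1
    have e2 := mf (sub _ ht) iB ht.2
    have e3 := mh iA (sub _ (hmem _ ht)) (hmem _ ht).1
    have e4 := mh (sub _ (hmem _ ht)) iB (hmem _ ht).2
    by_cases h0 : 0 ≤ f a
    · have : 0 ≤ h a := by
        rw [← sign_nonneg_iff, ← sa, sign_nonneg_iff]; exact h0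
      rw [sign_pos (by linarith), sign_pos (by linarith)]
    · have h1 : f b ≤ 0 := by
        by_contra h1
        push Not at h0 h1
        obtain ⟨s, hs, hs'⟩ := intermediate_value_Ioo hab.le hf.continuousOn ⟨h0, h1⟩
        exact hw ⟨s, hs, hs'⟩
      have : h b ≤ 0 := by
        rw [← sign_nonpos_iff, ← sb, sign_nonpos_iff]; exact h1
      rw [sign_neg (by linarith), sign_neg (by linarith)]

theorem ts_gap_exists (Z : Finset ℝ) (M t : ℝ) (hM : M ∈ Z) (hM' : -M ∈ Z) (ht : t ∉ Z)
    (h1 : -M < t) (h2 : t < M) :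
    ∃ a ∈ Z, ∃ b ∈ Z, t ∈ Set.Ioo a b ∧ ∀ z ∈ Z, z ∉ Set.Ioo a b := by
  obtain ⟨a, ha, ha'⟩ := (Z.filter (· < t)).exists_max_image id ⟨-M, by simp [hM', h1]⟩
  obtain ⟨b, hb, hb'⟩ := (Z.filter (t < ·)).exists_min_image id ⟨M, by simp [hM, h2]⟩
  simp only [Finset.mem_filter, id] at *
  refine ⟨a, ha.1, b, hb.1, ⟨ha.2, hb.2⟩, fun z hz hz' => ?_⟩
  rcases lt_trichotomy z t with h | h | h
  · exact absurd (ha' z ⟨hz, h⟩) (not_le.2 hz'.1)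
  · exact ht (h ▸ hz)
  · exact absurd (hb' z ⟨hz, h⟩) (not_le.2 hz'.2)

theorem ts_core (f h : ℝ → ℝ) (hf : Continuous f) (hh : Continuous h) (Z : Finset ℝ)
    (M : ℝ) (hM0 : 0 < M) (σ τ : SignType)
    (hσ : ∀ t, M ≤ t → SignType.sign (f t) = σ ∧ SignType.sign (h t) = σ)
    (hτ : ∀ t, t ≤ -M → SignType.sign (f t) = τ ∧ SignType.sign (h t) = τ)
    (hZ : ∀ t ∈ Z, SignType.sign (f t) = SignType.sign (h t))
    (hmono : ∀ a b, a < b → (∀ z ∈ Z, z ∉ Set.Ioo a b) →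
      (StrictMonoOn f (Set.Icc a b) ∧ StrictMonoOn h (Set.Icc a b)) ∨
      (StrictAntiOn f (Set.Icc a b) ∧ StrictAntiOn h (Set.Icc a b)))
    (hfin : {t | f t = 0}.Finite) :
    ∃ ψ : ℝ ≃o ℝ, (∀ t ∈ Z, ψ t = t) ∧
      ∀ t, SignType.sign (f t) = SignType.sign (h (ψ t)) := by
  classical
  -- enlarge Z
  wlog hMZ : M ∈ Z ∧ -M ∈ Z generalizing Z
  · obtain ⟨ψ, h1, h2⟩ := this (insert M (insert (-M) Z)) (by
      intro t ht
      simp only [Finset.mem_insert] at ht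
      rcases ht with rfl | rfl | ht
      · rw [(hσ _ le_rfl).1, (hσ _ le_rfl).2]
      · rw [(hτ _ le_rfl).1, (hτ _ le_rfl).2]
      · exact hZ t ht) (by
      intro a b hab hz
      exact hmono a b hab (fun z hz' => hz z (by simp [hz']))) (by simp)
    exact ⟨ψ, fun t ht => h1 t (by simp [ht]), h2⟩
  obtain ⟨hM, hM'⟩ := hMZ
  have key : ∀ W : Finset ℝ, (∀ w ∈ W, w ∉ Z ∧ -M < w ∧ w < M ∧ f w = 0) →
      ∃ ψ : ℝ ≃o ℝ, (∀ t ∈ Z, ψ t = t) ∧ ∀ w ∈ W, h (ψ w) = 0 := by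
    intro W
    induction W using Finset.induction_on with
    | empty => intro _; exact ⟨OrderIso.refl ℝ, by simp, by simp⟩
    | insert w W hw ih =>
      intro hW
      obtain ⟨ψ, h1, h2⟩ := ih (fun w' hw' => hW w' (by simp [hw']))
      obtain ⟨wZ, w1, w2, fw⟩ := hW w (by simp)
      obtain ⟨a, ha, b, hb, hwab, hgap⟩ := ts_gap_exists Z M w hM hM' wZ w1 w2
      have hab : a < b := hwab.1.trans hwab.2
      have hs : ∃ s ∈ Set.Ioo a b, h s = 0 := by
        rcases hmono a b hab hgap with ⟨m1, m2⟩ | ⟨m1, m2⟩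
        · exact ts_gap_zero f h hh a b w hwab fw (hZ a ha) (hZ b hb) m1
        · obtain ⟨s, hs, hs'⟩ := ts_gap_zero (fun t => - f t) (fun t => - h t) hh.neg a b w hwab
            (by simp [fw]) (by simp [Left.sign_neg, hZ a ha]) (by simp [Left.sign_neg, hZ b hb])
            m1.neg
          exact ⟨s, hs, by simpa using hs'⟩
      have hinj : Set.InjOn f (Set.Icc a b) := by
        rcases hmono a b hab hgap with ⟨m1, m2⟩ | ⟨m1, m2⟩
        · exact m1.injOn
        · exact m1.injOn
      obtain ⟨s, hs, hs0⟩ := hs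
      have hψw : ψ w ∈ Set.Ioo a b := by
        constructor
        · rw [← h1 a ha]; exact ψ.strictMono hwab.1
        · rw [← h1 b hb]; exact ψ.strictMono hwab.2
      obtain ⟨χ, c1, c2⟩ := ts_bump a b (ψ w) s hψw hs
      refine ⟨ψ.trans χ, ?_, ?_⟩
      · intro t ht
        simp only [OrderIso.trans_apply]
        rw [h1 t ht, c2 t (hgap t ht)]
      · intro w' hw'
        simp only [OrderIso.trans_apply]
        rcases Finset.mem_insert.1 hw' with rfl | hw''
        · rw [c1, hs0]
        · have : ψ w' ∉ Set.Ioo a b := by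
            intro hc
            have hc1 : a < w' := by
              rw [← ψ.lt_iff_lt, h1 a ha]; exact hc.1
            have hc2 : w' < b := by
              rw [← ψ.lt_iff_lt, h1 b hb]; exact hc.2
            have : w' = w := hinj ⟨hc1.le, hc2.le⟩ ⟨hwab.1.le, hwab.2.le⟩
              (by rw [fw, (hW w' hw').2.2.2])
            exact hw (this ▸ hw'')
          rw [c2 _ this, h2 w' hw'']
  obtain ⟨ψ, h1, h2⟩ := key (hfin.toFinset.filter (fun w => w ∉ Z ∧ -M < w ∧ w < M))
    (by intro w hw; simp at hw; tauto)
  refine ⟨ψ, h1, fun t => ?_⟩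
  by_cases htZ : t ∈ Z
  · rw [h1 t htZ, hZ t htZ]
  by_cases ht1 : M ≤ t
  · rw [(hσ t ht1).1, (hσ (ψ t) (by rw [← h1 M hM]; exact ψ.monotone ht1)).2]
  by_cases ht2 : t ≤ -M
  · rw [(hτ t ht2).1, (hτ (ψ t) (by rw [← h1 (-M) hM']; exact ψ.monotone ht2)).2]
  push Not at ht1 ht2
  obtain ⟨a, ha, b, hb, htab, hgap⟩ := ts_gap_exists Z M t hM hM' htZ ht2 ht1
  have hab : a < b := htab.1.trans htab.2
  have bnd : ∀ z ∈ Set.Ioo a b, f z = 0 → h (ψ z) = 0 := by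
    intro z hz hfz
    have hzZ : z ∉ Z := fun hc => hgap z hc hz
    by_cases hz1 : M ≤ z
    · exact absurd ⟨htab.1.trans ht1, lt_of_le_of_lt hz1 hz.2⟩ (hgap M hM)
    by_cases hz2 : z ≤ -M
    · exact absurd ⟨lt_of_lt_of_le hz.1 hz2, ht2.trans htab.2⟩ (hgap (-M) hM')
    push Not at hz1 hz2
    exact h2 z (by simp [hfz, hzZ, hz1, hz2])
  rcases hmono a b hab hgap with ⟨m1, m2⟩ | ⟨m1, m2⟩
  · exact ts_gap_sign f h hf a b t _ ψ htab rfl (h1 a ha) (h1 b hb) bnd (hZ a ha) (hZ b hb) m1 m2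
  · have := ts_gap_sign (fun t => - f t) (fun t => - h t) hf.neg a b t _ ψ htab rfl
      (h1 a ha) (h1 b hb) (by simpa using bnd)
      (by simp [Left.sign_neg, hZ a ha]) (by simp [Left.sign_neg, hZ b hb]) m1.neg m2.neg
    simpa [Left.sign_neg] using this

theorem ts_sign_const (f : ℝ → ℝ) (hf : Continuous f) (a b : ℝ) (hab : a ≤ b)
    (h0 : ∀ t ∈ Set.Icc a b, f t ≠ 0) : SignType.sign (f a) = SignType.sign (f b) := by
  rcases lt_or_gt_of_ne (h0 a ⟨le_rfl, hab⟩) with ha | ha <;>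
    rcases lt_or_gt_of_ne (h0 b ⟨hab, le_rfl⟩) with hb | hb
  · rw [sign_neg ha, sign_neg hb]
  · obtain ⟨t, ht, ht'⟩ := intermediate_value_Icc hab hf.continuousOn ⟨ha.le, hb.le⟩
    exact absurd ht' (h0 t ht)
  · obtain ⟨t, ht, ht'⟩ := intermediate_value_Icc' hab hf.continuousOn ⟨hb.le, ha.le⟩
    exact absurd ht' (h0 t ht)
  · rw [sign_pos ha, sign_pos hb]

theorem ts_transfer (f h : ℝ → ℝ) (hf : Continuous f) (θ θ' : ℝ ≃o ℝ) (Z : Finset ℝ)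
    (hs : ∀ t, SignType.sign (f t) = SignType.sign (h (θ t)))
    (hZ : ∀ t, f t = 0 → t ∈ Z) (hθ : ∀ t ∈ Z, θ' t = θ t) (t : ℝ) :
    SignType.sign (f t) = SignType.sign (h (θ' t)) := by
  by_cases htZ : t ∈ Z
  · rw [hθ t htZ, hs]
  obtain ⟨s, hst⟩ : ∃ s, θ s = θ' t := ⟨θ.symm (θ' t), by simp⟩
  rw [← hst, ← hs]
  rcases le_total s t with h1 | h1
  · refine (ts_sign_const f hf s t h1 (fun z hz hz0 => ?_)).symm
    have hzZ := hZ z hz0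
    have h2 : z < t := lt_of_le_of_ne hz.2 (fun hc => htZ (hc ▸ hzZ))
    have h3 : θ s ≤ θ z := θ.monotone hz.1
    rw [← hθ z hzZ, hst] at h3
    exact absurd (θ'.strictMono h2) (not_lt.2 h3)
  · refine (ts_sign_const f hf t s h1 (fun z hz hz0 => ?_))
    have hzZ := hZ z hz0
    have h2 : t < z := lt_of_le_of_ne hz.1 (fun hc => htZ (hc ▸ hzZ))
    have h3 : θ z ≤ θ s := θ.monotone hz.2
    rw [← hθ z hzZ, hst] at h3
    exact absurd (θ'.strictMono h2) (not_lt.2 h3)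

open Filter Topology Asymptotics in
theorem ts_sign_equiv {l : Filter ℝ} {u v : ℝ → ℝ} (h : u ~[l] v) :
    ∀ᶠ t in l, SignType.sign (u t) = SignType.sign (v t) := by
  obtain ⟨c, hc, he⟩ := h.exists_eq_mul
  filter_upwards [he, hc.eventually (lt_mem_nhds (zero_lt_one : (0:ℝ) < 1))] with t h1 h2
  rw [h1]
  simp only [Pi.mul_apply, sign_mul, sign_pos h2, one_mul]

open Filter Topology Asymptotics in
theorem ts_top (f : Polynomial ℝ) :
    ∀ᶠ t in atTop, SignType.sign (f.eval t) = SignType.sign f.leadingCoeff := by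
  filter_upwards [ts_sign_equiv f.isEquivalent_atTop_lead, eventually_gt_atTop 0] with t h1 h2
  rw [h1, sign_mul, sign_pow, sign_pos h2]; simp

open Filter Topology Asymptotics in
theorem ts_bot (f : Polynomial ℝ) :
    ∀ᶠ t in atBot, SignType.sign (f.eval t) =
      SignType.sign f.leadingCoeff * (-1) ^ f.natDegree := by
  filter_upwards [ts_sign_equiv f.isEquivalent_atBot_lead, eventually_lt_atBot 0] with t h1 h2
  rw [h1, sign_mul, sign_pow, sign_neg h2]

theorem ts_natDegree (f g : Polynomial ℝ)
    (hc : ∀ i, SignType.sign (f.coeff i) = SignType.sign (g.coeff i)) :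
    f.natDegree = g.natDegree := by
  have : ∀ i, f.coeff i = 0 ↔ g.coeff i = 0 := by
    intro i
    rw [← sign_eq_zero_iff, hc, sign_eq_zero_iff]
  apply le_antisymm <;> rw [Polynomial.natDegree_le_iff_coeff_eq_zero] <;> intro N hN
  · rw [this]; exact Polynomial.coeff_eq_zero_of_natDegree_lt hN
  · rw [← this]; exact Polynomial.coeff_eq_zero_of_natDegree_lt hN

open Filter Topology in
theorem ts_step (f g : Polynomial ℝ) (θ : ℝ ≃o ℝ) (Z : Finset ℝ)
    (hc : ∀ i, SignType.sign (f.coeff i) = SignType.sign (g.coeff i))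
    (hd0 : f.derivative ≠ 0)
    (hd : ∀ t, SignType.sign (f.derivative.eval t) = SignType.sign (g.derivative.eval (θ t)))
    (hZd : ∀ t, f.derivative.eval t = 0 → t ∈ Z)
    (hZ : ∀ t ∈ Z, SignType.sign (f.eval t) = SignType.sign (g.eval (θ t))) :
    ∃ θ' : ℝ ≃o ℝ, (∀ t ∈ Z, θ' t = θ t) ∧
      ∀ t, SignType.sign (f.eval t) = SignType.sign (g.eval (θ' t)) := by
  have hf0 : f ≠ 0 := by rintro rfl; simp at hd0
  have hdeg := ts_natDegree f g hc
  have hlc : SignType.sign f.leadingCoeff = SignType.sign g.leadingCoeff := by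
    rw [Polynomial.leadingCoeff, Polynomial.leadingCoeff, ← hdeg, hc]
  have hT : ∃ M, ∀ t, M ≤ t → SignType.sign (f.eval t) = SignType.sign f.leadingCoeff ∧
      SignType.sign (g.eval (θ t)) = SignType.sign f.leadingCoeff := by
    have := (ts_top f).and (θ.tendsto_atTop.eventually (ts_top g))
    rw [← hlc] at this
    exact eventually_atTop.1 this
  have hB : ∃ M, ∀ t, t ≤ M →
      SignType.sign (f.eval t) = SignType.sign f.leadingCoeff * (-1) ^ f.natDegree ∧
      SignType.sign (g.eval (θ t)) = SignType.sign f.leadingCoeff * (-1) ^ f.natDegree := by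
    have := (ts_bot f).and (θ.tendsto_atBot.eventually (ts_bot g))
    rw [← hlc, ← hdeg] at this
    exact eventually_atBot.1 this
  obtain ⟨M1, hM1⟩ := hT
  obtain ⟨M2, hM2⟩ := hB
  obtain ⟨ψ, h1, h2⟩ := ts_core (fun t => f.eval t) (fun t => g.eval (θ t)) f.continuous
    (g.continuous.comp θ.continuous) Z (max 1 (max M1 (-M2))) (by positivity)
    _ _ (fun t ht => hM1 t (by
      exact (le_trans (le_max_left _ _) (le_max_right _ _)).trans ht))
    (fun t ht => hM2 t (by
      have : -M2 ≤ max 1 (max M1 (-M2)) := le_trans (le_max_right _ _) (le_max_right _ _)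
      linarith)) hZ (by
      intro a b hab hz
      have hnz : ∀ t ∈ Set.Ioo a b, f.derivative.eval t ≠ 0 :=
        fun t ht h0 => hz t (hZd t h0) ht
      have hconst : ∀ s ∈ Set.Ioo a b, ∀ t ∈ Set.Ioo a b,
          SignType.sign (f.derivative.eval s) = SignType.sign (f.derivative.eval t) := by
        intro s hs t ht
        rcases le_total s t with h | h
        · exact ts_sign_const (fun t => f.derivative.eval t) f.derivative.continuous s t h
            (fun z hz => hnz z ⟨hs.1.trans_le hz.1, hz.2.trans_lt ht.2⟩)
        · exact (ts_sign_const (fun t => f.derivative.eval t) f.derivative.continuous t s h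
            (fun z hz => hnz z ⟨ht.1.trans_le hz.1, hz.2.trans_lt hs.2⟩)).symm
      have hmid : (a + b) / 2 ∈ Set.Ioo a b := ⟨by linarith, by linarith⟩
      have hpre : ∀ t ∈ Set.Ioo (θ a) (θ b), ∃ s ∈ Set.Ioo a b, θ s = t := by
        intro t ht
        refine ⟨θ.symm t, ⟨?_, ?_⟩, by simp⟩
        · rw [← θ.lt_iff_lt]; simpa using ht.1
        · rw [← θ.lt_iff_lt]; simpa using ht.2
      have hmap : ∀ t ∈ Set.Icc a b, θ t ∈ Set.Icc (θ a) (θ b) :=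
        fun t ht => ⟨θ.monotone ht.1, θ.monotone ht.2⟩
      rcases lt_or_gt_of_ne (hnz _ hmid) with hm | hm
      · right
        constructor
        · apply strictAntiOn_of_deriv_neg (convex_Icc a b) f.continuous.continuousOn
          intro t ht
          rw [interior_Icc] at ht
          rw [Polynomial.deriv, ← sign_eq_neg_one_iff, hconst t ht _ hmid, sign_neg hm]
        · have : StrictAntiOn (fun t => g.eval t) (Set.Icc (θ a) (θ b)) := by
            apply strictAntiOn_of_deriv_neg (convex_Icc _ _) g.continuous.continuousOn
            intro t ht
            rw [interior_Icc] at ht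
            obtain ⟨s, hs, rfl⟩ := hpre t ht
            rw [Polynomial.deriv, ← sign_eq_neg_one_iff, ← hd, hconst s hs _ hmid, sign_neg hm]
          intro s hs t ht hst
          exact this (hmap s hs) (hmap t ht) (θ.strictMono hst)
      · left
        constructor
        · apply strictMonoOn_of_deriv_pos (convex_Icc a b) f.continuous.continuousOn
          intro t ht
          rw [interior_Icc] at ht
          rw [Polynomial.deriv, ← sign_eq_one_iff, hconst t ht _ hmid, sign_pos hm]
        · have : StrictMonoOn (fun t => g.eval t) (Set.Icc (θ a) (θ b)) := by
            apply strictMonoOn_of_deriv_pos (convex_Icc _ _) g.continuous.continuousOn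
            intro t ht
            rw [interior_Icc] at ht
            obtain ⟨s, hs, rfl⟩ := hpre t ht
            rw [Polynomial.deriv, ← sign_eq_one_iff, ← hd, hconst s hs _ hmid, sign_pos hm]
          intro s hs t ht hst
          exact this (hmap s hs) (hmap t ht) (θ.strictMono hst))
      (Polynomial.finite_setOfPred_isRoot hf0)
  refine ⟨ψ.trans θ, ?_, ?_⟩
  · intro t ht
    simp [h1 t ht]
  · intro t
    simpa using h2 t

/-- pseudo-division -/
theorem ts_pseudo {R : Type*} [CommRing R] (Q : Polynomial R) (j : ℕ) (hQ : Q.natDegree ≤ j)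
    (N : ℕ) : ∀ P : Polynomial R, P.natDegree ≤ N →
    ∃ (r S : Polynomial R) (e : ℕ), (r.natDegree < j ∨ r = 0) ∧
      Polynomial.C (Q.coeff j ^ (2 * e)) * P = S * Q + r := by
  by_cases hj0 : j = 0
  · subst hj0
    intro P _
    refine ⟨0, Polynomial.C (Q.coeff 0) * P, 1, Or.inr rfl, ?_⟩
    have : Q = Polynomial.C (Q.coeff 0) := Polynomial.eq_C_of_natDegree_le_zero hQ
    conv_rhs => rw [this]
    simp only [Polynomial.coeff_C_zero, Polynomial.C_pow]
    ring
  induction N with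
  | zero =>
    intro P hP
    refine ⟨P, 0, 0, Or.inl (by omega), by simp⟩
  | succ N ih =>
    intro P hP
    by_cases hlt : N + 1 < j
    · exact ⟨P, 0, 0, Or.inl (by omega), by simp⟩
    push Not at hlt
    set a := Q.coeff j with ha
    let P1 := Polynomial.C (a ^ 2) * P -
      Polynomial.C (a * P.coeff (N + 1)) * Polynomial.X ^ (N + 1 - j) * Q
    have hP1 : P1.natDegree ≤ N := by
      rw [Polynomial.natDegree_le_iff_coeff_eq_zero]
      intro k hk
      simp only [P1, Polynomial.coeff_sub, Polynomial.coeff_C_mul, mul_assoc,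
        Polynomial.coeff_X_pow_mul']
      rw [if_pos (by omega)]
      rcases Nat.lt_or_ge (N + 1) k with h | h
      · rw [Polynomial.coeff_eq_zero_of_natDegree_lt (p := P) (by omega),
          Polynomial.coeff_eq_zero_of_natDegree_lt (p := Q) (by omega)]
        simp
      · have : k = N + 1 := by omega
        subst this
        rw [show N + 1 - (N + 1 - j) = j by omega, ← ha]
        ring
    obtain ⟨r, S, e, hr, he⟩ := ih P1 hP1
    refine ⟨r, S + Polynomial.C (a ^ (2 * e)) * (Polynomial.C (a * P.coeff (N + 1)) * Polynomial.X ^ (N + 1 - j)), e + 1, hr, ?_⟩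
    have : Polynomial.C (a ^ (2 * (e + 1))) * P = Polynomial.C (a ^ (2 * e)) * P1 +
      Polynomial.C (a ^ (2 * e)) * (Polynomial.C (a * P.coeff (N + 1)) * Polynomial.X ^ (N + 1 - j)) * Q := by
      simp only [P1, Polynomial.C_pow, Polynomial.C_mul]
      ring
    rw [this, he]
    ring

/-- sign-diagram determined by finitely many coefficients -/
def TSGood {R : Type} [CommRing R] (F : Finset (Polynomial R)) : Prop :=
  ∃ G : Finset R, ∀ e e' : R →+* ℝ, (∀ g ∈ G, SignType.sign (e g) = SignType.sign (e' g)) →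
    ∃ θ : ℝ ≃o ℝ, ∀ Q ∈ F, ∀ t, SignType.sign ((Q.map e).eval t) =
      SignType.sign ((Q.map e').eval (θ t))

theorem TSGood.mono {R : Type} [CommRing R] {F F' : Finset (Polynomial R)} (h : TSGood F)
    (hs : F' ⊆ F) : TSGood F' := by
  obtain ⟨G, hG⟩ := h
  refine ⟨G, fun e e' he => ?_⟩
  obtain ⟨θ, hθ⟩ := hG e e' he
  exact ⟨θ, fun Q hQ => hθ Q (hs hQ)⟩

/-- truncation -/
noncomputable def tsTr {R : Type} [CommRing R] (Q : Polynomial R) (j : ℕ) : Polynomial R :=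
  ∑ i ∈ Finset.range (j + 1), Polynomial.monomial i (Q.coeff i)

theorem tsTr_coeff {R : Type} [CommRing R] (Q : Polynomial R) (j k : ℕ) :
    (tsTr Q j).coeff k = if k ≤ j then Q.coeff k else 0 := by
  simp [tsTr, Polynomial.finsetSum_coeff, Polynomial.coeff_monomial]

theorem tsTr_natDegree {R : Type} [CommRing R] (Q : Polynomial R) (j : ℕ) :
    (tsTr Q j).natDegree ≤ j := by
  rw [Polynomial.natDegree_le_iff_coeff_eq_zero]
  intro k hk
  rw [tsTr_coeff, if_neg (by omega)]

theorem tsTr_map {R : Type} [CommRing R] (Q : Polynomial R) (j : ℕ) (e : R →+* ℝ)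
    (h : (Q.map e).natDegree ≤ j) : (tsTr Q j).map e = Q.map e := by
  ext k
  rw [Polynomial.coeff_map, tsTr_coeff]
  split_ifs with hk
  · simp
  · rw [Polynomial.coeff_eq_zero_of_natDegree_lt (p := Q.map e) (by omega), map_zero]

theorem ts_rem_sign {R : Type} [CommRing R] (P Q r S : Polynomial R) (j k : ℕ) (e : R →+* ℝ)
    (h : (Q.map e).natDegree = j) (h0 : Q.map e ≠ 0)
    (hr : Polynomial.C ((tsTr Q j).coeff j ^ (2 * k)) * P = S * tsTr Q j + r)
    (t : ℝ) (ht : (Q.map e).eval t = 0) :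
    SignType.sign ((P.map e).eval t) = SignType.sign ((r.map e).eval t) := by
  have h1 := congrArg (fun p => (Polynomial.map e p).eval t) hr
  simp only [Polynomial.map_mul, Polynomial.map_add, tsTr_map Q j e h.le, Polynomial.eval_mul,
    Polynomial.eval_add, ht, Polynomial.map_C, Polynomial.eval_C, tsTr_coeff, le_refl, if_true,
    mul_zero, zero_add] at h1
  have h2 : e (Q.coeff j) ≠ 0 := by
    have : (Q.map e).leadingCoeff ≠ 0 := Polynomial.leadingCoeff_ne_zero.2 h0
    rwa [Polynomial.leadingCoeff, h, Polynomial.coeff_map] at this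
  have h3 : 0 < (e (Q.coeff j) ^ 2) ^ k := by positivity
  rw [← h1, sign_mul, map_pow, pow_mul, sign_pos h3, one_mul]

open Classical in
theorem ts_good_step {R : Type} [CommRing R] (K : Finset (Polynomial R)) (P : Polynomial R)
    (rem : Polynomial R → ℕ → Polynomial R)
    (hrem : ∀ Q j, ∃ (S : Polynomial R) (k : ℕ),
      Polynomial.C ((tsTr Q j).coeff j ^ (2 * k)) * P = S * tsTr Q j + rem Q j)
    (h : TSGood ((insert P.derivative K) ∪ (insert P.derivative K).biUnion
      (fun Q => (Finset.range (Q.natDegree + 1)).image (rem Q)))) :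
    TSGood (insert P K) := by
  obtain ⟨G, hG⟩ := h
  refine ⟨G ∪ (insert P (insert P.derivative K)).biUnion
    (fun Q => (Finset.range (Q.natDegree + 1)).image Q.coeff), fun e e' he => ?_⟩
  have hco : ∀ Q ∈ insert P (insert P.derivative K), ∀ i,
      SignType.sign ((Q.map e).coeff i) = SignType.sign ((Q.map e').coeff i) := by
    intro Q hQ i
    rw [Polynomial.coeff_map, Polynomial.coeff_map]
    by_cases hi : i ≤ Q.natDegree
    · apply he
      apply Finset.mem_union_right
      rw [Finset.mem_biUnion]
      exact ⟨Q, hQ, Finset.mem_image.2 ⟨i, by simp; omega, rfl⟩⟩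
    · rw [Polynomial.coeff_eq_zero_of_natDegree_lt (p := Q) (by omega)]
      simp
  obtain ⟨θ, hθ⟩ := hG e e' (fun g hg => he g (Finset.mem_union_left _ hg))
  have hθK : ∀ Q ∈ insert P.derivative K, ∀ t, SignType.sign ((Q.map e).eval t) =
      SignType.sign ((Q.map e').eval (θ t)) :=
    fun Q hQ => hθ Q (Finset.mem_union_left _ hQ)
  have hcoP := hco P (by simp)
  by_cases hd : (P.map e).derivative = 0
  · have hd1 : (P.map e).natDegree = 0 := Polynomial.derivative_eq_zero.1 hd
    have hd2 : (P.map e').natDegree = 0 := by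
      rw [← ts_natDegree _ _ hcoP]; exact hd1
    refine ⟨θ, fun Q hQ t => ?_⟩
    rcases Finset.mem_insert.1 hQ with rfl | hQ
    · rw [Polynomial.eq_C_of_natDegree_eq_zero hd1, Polynomial.eq_C_of_natDegree_eq_zero hd2]
      simp only [Polynomial.eval_C]
      exact hcoP 0
    · exact hθK Q (Finset.mem_insert_of_mem hQ) t
  · let Z : Finset ℝ := (insert P.derivative K).biUnion (fun Q => (Q.map e).roots.toFinset)
    have hZ : ∀ Q ∈ insert P.derivative K, Q.map e ≠ 0 → ∀ t, (Q.map e).eval t = 0 → t ∈ Z := by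
      intro Q hQ h0 t ht
      rw [Finset.mem_biUnion]
      exact ⟨Q, hQ, by rw [Multiset.mem_toFinset, Polynomial.mem_roots h0]; exact ht⟩
    obtain ⟨θ', h1, h2⟩ := ts_step (P.map e) (P.map e') θ Z hcoP hd
      (by
        intro t
        rw [Polynomial.derivative_map, Polynomial.derivative_map]
        exact hθK _ (by simp) t)
      (by
        rw [Polynomial.derivative_map] at hd ⊢
        exact hZ _ (by simp) hd)
      (by
        intro t ht
        obtain ⟨Q, hQ, hQt⟩ := Finset.mem_biUnion.1 ht
        rw [Multiset.mem_toFinset] at hQt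
        have hQ0 : Q.map e ≠ 0 := by
          rintro h0; rw [h0] at hQt; simp at hQt
        rw [Polynomial.mem_roots hQ0] at hQt
        have hQt : (Q.map e).eval t = 0 := hQt
        have hcQ := hco Q (Finset.mem_insert_of_mem hQ)
        have hdeg := ts_natDegree _ _ hcQ
        have hQt' : (Q.map e').eval (θ t) = 0 := by
          rw [← sign_eq_zero_iff, ← hθK Q hQ t, hQt]; simp
        have hQ0' : Q.map e' ≠ 0 := by
          intro h0
          apply hQ0
          ext i
          have := hcQ i
          rw [h0] at this
          simp only [Polynomial.coeff_zero, sign_zero] at this ⊢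
          exact sign_eq_zero_iff.1 this
        obtain ⟨S, k, hS⟩ := hrem Q (Q.map e).natDegree
        rw [ts_rem_sign P Q _ S _ k e rfl hQ0 hS t hQt,
          ts_rem_sign P Q _ S _ k e' hdeg.symm hQ0' hS (θ t) hQt']
        apply hθ
        apply Finset.mem_union_right
        rw [Finset.mem_biUnion]
        refine ⟨Q, hQ, Finset.mem_image.2 ⟨_, ?_, rfl⟩⟩
        rw [Finset.mem_range, Nat.lt_succ_iff]
        exact Polynomial.natDegree_map_le)
    refine ⟨θ', fun Q hQ t => ?_⟩
    rcases Finset.mem_insert.1 hQ with rfl | hQ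
    · exact h2 t
    · have hQ' := Finset.mem_insert_of_mem (b := P.derivative) hQ
      by_cases hQ0 : Q.map e = 0
      · have : Q.map e' = 0 := by
          ext i
          have := hco Q (Finset.mem_insert_of_mem hQ') i
          rw [hQ0] at this
          simp only [Polynomial.coeff_zero, sign_zero] at this ⊢
          exact sign_eq_zero_iff.1 this.symm
        rw [hQ0, this]; simp
      · exact ts_transfer (fun t => (Q.map e).eval t) (fun t => (Q.map e').eval t)
          (Q.map e).continuous θ θ' Z (hθK Q hQ') (hZ Q hQ' hQ0) h1 t

open Classical in
theorem ts_good {R : Type} [CommRing R] (D : ℕ) : ∀ F : Finset (Polynomial R),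
    (∀ Q ∈ F, Q.natDegree ≤ D) → TSGood F := by
  induction D with
  | zero =>
    intro F hF
    refine ⟨F.image (fun Q => Q.coeff 0), fun e e' he => ⟨OrderIso.refl ℝ, fun Q hQ t => ?_⟩⟩
    rw [Polynomial.eq_C_of_natDegree_le_zero (hF Q hQ)]
    simp only [Polynomial.map_C, Polynomial.eval_C]
    exact he _ (Finset.mem_image.2 ⟨Q, hQ, rfl⟩)
  | succ D ih =>
    have key : ∀ B : Finset (Polynomial R), (∀ Q ∈ B, Q.natDegree ≤ D + 1) →
        ∀ A : Finset (Polynomial R), (∀ Q ∈ A, Q.natDegree ≤ D) → TSGood (A ∪ B) := by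
      intro B
      induction B using Finset.induction_on with
      | empty => intro _ A hA; simpa using ih A hA
      | insert P B hP ihB =>
        intro hB A hA
        have hdiv : ∀ (Q : Polynomial R) (j : ℕ), ∃ (r S : Polynomial R) (k : ℕ),
            (r.natDegree < j ∨ r = 0) ∧
            Polynomial.C ((tsTr Q j).coeff j ^ (2 * k)) * P = S * tsTr Q j + r :=
          fun Q j => ts_pseudo (tsTr Q j) j (tsTr_natDegree Q j) _ P le_rfl
        choose rem S k hr hrem using hdiv
        have hBB : ∀ Q ∈ B, Q.natDegree ≤ D + 1 := fun Q hQ => hB Q (by simp [hQ])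
        have hPd : P.derivative.natDegree ≤ D := by
          have := Polynomial.natDegree_derivative_le P
          have := hB P (by simp)
          omega
        have := ts_good_step (A ∪ B) P rem (fun Q j => ⟨S Q j, k Q j, hrem Q j⟩) (by
          refine TSGood.mono (ihB hBB (insert P.derivative A ∪
            (insert P.derivative (A ∪ B)).biUnion
              (fun Q => (Finset.range (Q.natDegree + 1)).image (rem Q))) ?_) ?_
          · intro Q hQ
            rcases Finset.mem_union.1 hQ with hQ | hQ
            · rcases Finset.mem_insert.1 hQ with rfl | hQ
              · exact hPd
              · exact hA Q hQ
            · obtain ⟨T, hT, hQ⟩ := Finset.mem_biUnion.1 hQ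
              obtain ⟨j, hj, rfl⟩ := Finset.mem_image.1 hQ
              have hTd : T.natDegree ≤ D + 1 := by
                rcases Finset.mem_insert.1 hT with rfl | hT
                · omega
                · rcases Finset.mem_union.1 hT with hT | hT
                  · have := hA T hT; omega
                  · exact hBB T hT
              rw [Finset.mem_range] at hj
              rcases hr T j with h | h
              · omega
              · rw [h]; simp
          · intro Q hQ
            simp only [Finset.mem_union, Finset.mem_insert] at hQ ⊢
            tauto)
        refine this.mono ?_
        intro Q hQ
        simp only [Finset.mem_union, Finset.mem_insert] at hQ ⊢
        tauto
    intro F hF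
    simpa using key F hF ∅ (by simp)

theorem ts_good_all {R : Type} [CommRing R] (F : Finset (Polynomial R)) : TSGood F :=
  ts_good (F.sup Polynomial.natDegree) F (fun _ hQ => Finset.le_sup (f := Polynomial.natDegree) hQ)

/-- membership determined by the signs of finitely many polynomials -/
def TSD {ι : Type} (S : Set (ι → ℝ)) : Prop :=
  ∃ G : Finset (MvPolynomial ι ℝ), ∀ x x' : ι → ℝ,
    (∀ g ∈ G, SignType.sign (MvPolynomial.eval x g) = SignType.sign (MvPolynomial.eval x' g)) →
    x ∈ S → x' ∈ S

theorem TSD.compl {ι : Type} {S : Set (ι → ℝ)} (h : TSD S) : TSD Sᶜ := by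
  obtain ⟨G, hG⟩ := h
  exact ⟨G, fun x x' hx hxS hx' => hxS (hG x' x (fun g hg => (hx g hg).symm) hx')⟩

theorem TSD.inter {ι : Type} {S T : Set (ι → ℝ)} (h : TSD S) (h' : TSD T) : TSD (S ∩ T) := by
  classical
  obtain ⟨G, hG⟩ := h
  obtain ⟨G', hG'⟩ := h'
  exact ⟨G ∪ G', fun x x' hx hxS => ⟨hG x x' (fun g hg => hx g (by simp [hg])) hxS.1,
    hG' x x' (fun g hg => hx g (by simp [hg])) hxS.2⟩⟩

theorem TSD.union {ι : Type} {S T : Set (ι → ℝ)} (h : TSD S) (h' : TSD T) : TSD (S ∪ T) := by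
  have := (h.compl.inter h'.compl).compl
  rwa [← Set.compl_union, compl_compl] at this

theorem TSD.forallFin {ι : Type} {k : ℕ} {S : Fin k → Set (ι → ℝ)} (h : ∀ j, TSD (S j)) :
    TSD {x | ∀ j, x ∈ S j} := by
  classical
  choose G hG using h
  exact ⟨Finset.univ.biUnion G, fun x x' hx hxS j => hG j x x'
    (fun g hg => hx g (Finset.mem_biUnion.2 ⟨j, Finset.mem_univ _, hg⟩)) (hxS j)⟩

theorem TSD.comap {ι κ : Type} {S : Set (ι → ℝ)} (h : TSD S) (ρ : ι → κ) :
    TSD {z : κ → ℝ | (fun i => z (ρ i)) ∈ S} := by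
  classical
  obtain ⟨G, hG⟩ := h
  refine ⟨G.image (MvPolynomial.rename ρ), fun x x' hx hxS => hG _ _ (fun g hg => ?_) hxS⟩
  have := hx _ (Finset.mem_image_of_mem _ hg)
  simp only [MvPolynomial.eval_rename] at this
  exact this

theorem TSD.pos {ι : Type} (p : MvPolynomial ι ℝ) : TSD {x | 0 < MvPolynomial.eval x p} := by
  refine ⟨{p}, fun x x' hx hxS => ?_⟩
  have := hx p (by simp)
  rw [Set.mem_ofPred_eq] at hxS ⊢
  rw [sign_pos hxS] at this
  exact sign_eq_one_iff.1 this.symm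

theorem ts_eval_option {ι : Type} (x : ι → ℝ) (t : ℝ) (g : MvPolynomial (Option ι) ℝ) :
    MvPolynomial.eval (fun o : Option ι => o.elim t x) g =
      ((MvPolynomial.optionEquivLeft ℝ ι g).map (MvPolynomial.eval x)).eval t := by
  induction g using MvPolynomial.induction_on with
  | C a => simp
  | add p q hp hq => simp [hp, hq]
  | mul_X p i hp =>
    rw [map_mul, hp, map_mul, Polynomial.map_mul, Polynomial.eval_mul]
    cases i <;> simp

theorem TSD.exists_one {ι : Type} (P : (ι → ℝ) → ℝ → Prop)
    (h : TSD {z : Option ι → ℝ | P (fun i => z (some i)) (z none)}) : TSD {x | ∃ t, P x t} := by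
  classical
  obtain ⟨G, hG⟩ := h
  obtain ⟨G', hG'⟩ := ts_good_all (G.image (MvPolynomial.optionEquivLeft ℝ ι))
  refine ⟨G', fun x x' hx hxS => ?_⟩
  obtain ⟨t, ht⟩ := hxS
  obtain ⟨θ, hθ⟩ := hG' (MvPolynomial.eval x) (MvPolynomial.eval x') hx
  refine ⟨θ t, ?_⟩
  refine hG (fun o : Option ι => o.elim t x) (fun o : Option ι => o.elim (θ t) x') ?_ ht
  intro g hg
  rw [ts_eval_option, ts_eval_option]
  exact hθ _ (Finset.mem_image_of_mem _ hg) t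

theorem TSD.exists_fin (k : ℕ) : ∀ {ι : Type} (P : (ι → ℝ) → (Fin k → ℝ) → Prop),
    TSD {z : ι ⊕ Fin k → ℝ | P (fun i => z (Sum.inl i)) (fun j => z (Sum.inr j))} →
    TSD {x | ∃ y, P x y} := by
  induction k with
  | zero =>
    intro ι P h
    obtain ⟨G, hG⟩ := h.comap (κ := ι) (Sum.elim id Fin.elim0)
    refine ⟨G, fun x x' hx hxS => ?_⟩
    obtain ⟨y, hy⟩ := hxS
    have := hG x x' hx (by
      simp only [Set.mem_ofPred_eq]
      convert hy using 1
      rfl)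
    exact ⟨_, this⟩
  | succ k ih =>
    intro ι P h
    have h1 : TSD {x : ι → ℝ | ∃ t : ℝ, ∃ y : Fin k → ℝ, P x (Fin.cons t y)} := by
      apply TSD.exists_one (fun x t => ∃ y : Fin k → ℝ, P x (Fin.cons t y))
      apply ih (fun (z : Option ι → ℝ) y => P (fun i => z (some i)) (Fin.cons (z none) y))
      have := h.comap (κ := Option ι ⊕ Fin k) (Sum.elim (fun i => Sum.inl (some i))
        (Fin.cons (Sum.inl none) (fun j => Sum.inr j) : Fin (k + 1) → Option ι ⊕ Fin k))
      convert this using 1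
      ext z
      simp only [Set.mem_ofPred_eq, Sum.elim_inl, Sum.elim_inr]
      have : (Fin.cons (z (Sum.inl none)) (fun j => z (Sum.inr j)) : Fin (k + 1) → ℝ) =
        fun j => z ((Fin.cons (Sum.inl none) (fun j => Sum.inr j) :
          Fin (k + 1) → Option ι ⊕ Fin k) j) := by
        ext j
        refine Fin.cases ?_ (fun j => ?_) j <;> simp
      rw [this]
    convert h1 using 1
    ext x
    simp only [Set.mem_ofPred_eq]
    exact Fin.exists_fin_succ_pi

theorem IsSemialgebraic.tsd {n : ℕ} {S : Set (Fin n → ℝ)} (h : IsSemialgebraic S) : TSD S := by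
  classical
  obtain ⟨m, p, Q, rfl⟩ := h
  refine ⟨Finset.univ.biUnion (fun i => insert (p i) (Q i)), fun x x' hx hxS => ?_⟩
  rw [Set.mem_iUnion] at hxS ⊢
  obtain ⟨i, h1, h2⟩ := hxS
  have hx : ∀ g ∈ insert (p i) (Q i), SignType.sign (MvPolynomial.eval x g) =
      SignType.sign (MvPolynomial.eval x' g) :=
    fun g hg => hx g (Finset.mem_biUnion.2 ⟨i, Finset.mem_univ _, hg⟩)
  refine ⟨i, ?_, fun q hq => ?_⟩
  · rw [← sign_eq_zero_iff, ← hx _ (by simp), h1, sign_zero]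
  · rw [← sign_eq_one_iff, ← hx q (by simp [hq]), sign_pos (h2 q hq)]

theorem TSD.isSemialgebraic {n : ℕ} {S : Set (Fin n → ℝ)} (h : TSD S) : IsSemialgebraic S := by
  classical
  obtain ⟨G, hG⟩ := h
  let α := {σ : G → SignType // ∃ x ∈ S, ∀ g : G, SignType.sign (MvPolynomial.eval x g.1) = σ g}
  let en := Fintype.equivFin α
  let pp : α → MvPolynomial (Fin n) ℝ := fun σ =>
    ∑ g : G, if σ.1 g = 0 then g.1 ^ 2 else 0
  let QQ : α → Finset (MvPolynomial (Fin n) ℝ) := fun σ =>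
    Finset.univ.biUnion (fun g : G => if σ.1 g = 1 then {g.1} else if σ.1 g = -1 then {-g.1} else ∅)
  have key : ∀ (σ : α) (x : Fin n → ℝ),
      (MvPolynomial.eval x (pp σ) = 0 ∧ ∀ q ∈ QQ σ, 0 < MvPolynomial.eval x q) ↔
      ∀ g : G, SignType.sign (MvPolynomial.eval x g.1) = σ.1 g := by
    intro σ x
    have e1 : MvPolynomial.eval x (pp σ) = 0 ↔
        ∀ g : G, σ.1 g = 0 → MvPolynomial.eval x g.1 = 0 := by
      simp only [pp, map_sum]
      rw [Finset.sum_eq_zero_iff_of_nonneg]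
      · constructor
        · intro h g hg
          have := h g (Finset.mem_univ _)
          simpa [hg] using this
        · intro h g _
          split_ifs with hg
          · simp [h g hg]
          · simp
      · intro g _
        split_ifs
        · simp only [map_pow]; positivity
        · simp
    rw [e1]
    simp only [QQ, Finset.mem_biUnion, Finset.mem_univ, true_and, forall_exists_index]
    constructor
    · rintro ⟨h1, h2⟩ g
      rcases hs : σ.1 g with _ | _ | _
      · exact sign_eq_zero_iff.2 (h1 g hs)
      · have hs' : σ.1 g = -1 := hs
        have := h2 (-g.1) g (by rw [hs', if_neg (by decide), if_pos rfl]; simp)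
        rw [map_neg] at this
        exact sign_eq_neg_one_iff.2 (by linarith)
      · have hs' : σ.1 g = 1 := hs
        have := h2 (g.1) g (by rw [hs', if_pos rfl]; simp)
        exact sign_eq_one_iff.2 this
    · intro h
      refine ⟨fun g hg => sign_eq_zero_iff.1 ((h g).trans hg), fun q g hq => ?_⟩
      split_ifs at hq with h1 h2
      · rw [Finset.mem_singleton.1 hq]
        exact sign_eq_one_iff.1 ((h g).trans h1)
      · rw [Finset.mem_singleton.1 hq, map_neg]
        have := sign_eq_neg_one_iff.1 ((h g).trans h2)
        linarith
      · simp at hq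
  refine ⟨Fintype.card α, fun i => pp (en.symm i), fun i => QQ (en.symm i), ?_⟩
  ext x
  rw [Set.mem_iUnion]
  simp only [Set.mem_ofPred_eq, key]
  constructor
  · intro hx
    refine ⟨en ⟨fun g => SignType.sign (MvPolynomial.eval x g.1), x, hx, fun g => rfl⟩, fun g => ?_⟩
    simp
  · rintro ⟨i, hi⟩
    obtain ⟨y, hy, hy'⟩ := (en.symm i).2
    exact hG y x (fun g hg => (hy' ⟨g, hg⟩).trans (hi ⟨g, hg⟩).symm) hy

theorem TSD.of_iff {ι : Type} {S T : Set (ι → ℝ)} (h : TSD S) (hst : ∀ x, x ∈ T ↔ x ∈ S) :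
    TSD T := by
  rwa [Set.ext hst]

theorem TSD.closure {n : ℕ} {S : Set (Fin n → ℝ)} (h : TSD S) : TSD (closure S) := by
  have h1 : TSD {z : Option (Fin n) ⊕ Fin n → ℝ | ∀ i : Fin n,
      z ∈ {z : Option (Fin n) ⊕ Fin n → ℝ | 0 < MvPolynomial.eval z
        (MvPolynomial.X (Sum.inl none) -
          (MvPolynomial.X (Sum.inl (some i)) - MvPolynomial.X (Sum.inr i)) ^ 2 :
          MvPolynomial (Option (Fin n) ⊕ Fin n) ℝ)}} :=
    TSD.forallFin (fun i => TSD.pos _)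
  have h2 := (h.comap (κ := Option (Fin n) ⊕ Fin n) Sum.inr).inter h1
  have h3 := TSD.exists_fin n (ι := Option (Fin n))
    (fun z y => y ∈ S ∧ ∀ i, (z (some i) - y i) ^ 2 < z none)
    (h2.of_iff (by intro z; simp))
  have h4 : TSD {z : Option (Fin n) → ℝ | 0 < MvPolynomial.eval z
      (MvPolynomial.X none : MvPolynomial (Option (Fin n)) ℝ)} := TSD.pos _
  have h5 := TSD.exists_one (ι := Fin n)
    (fun x ε => 0 < ε ∧ ¬ ∃ y : Fin n → ℝ, y ∈ S ∧ ∀ i, (x i - y i) ^ 2 < ε)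
    ((h4.inter h3.compl).of_iff (by intro z; simp))
  refine h5.compl.of_iff ?_
  intro x
  simp only [Set.mem_compl_iff, Set.mem_ofPred_eq, not_exists, not_and, not_not]
  rw [Metric.mem_closure_iff]
  push Not
  constructor
  · intro hx ε hε
    obtain ⟨y, hy, hxy⟩ := hx (Real.sqrt ε) (Real.sqrt_pos.2 hε)
    refine ⟨y, hy, fun i => ?_⟩
    rw [dist_pi_lt_iff (Real.sqrt_pos.2 hε)] at hxy
    have := hxy i
    rw [Real.dist_eq] at this
    rw [← sq_abs]
    exact (Real.lt_sqrt (abs_nonneg _)).1 this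
  · intro hx ε hε
    obtain ⟨y, hy, hxy⟩ := hx (ε ^ 2) (by positivity)
    refine ⟨y, hy, ?_⟩
    rw [dist_pi_lt_iff hε]
    intro i
    rw [Real.dist_eq]
    exact abs_lt_of_sq_lt_sq (hxy i) hε.le

theorem TSD.coborder {n : ℕ} {S : Set (Fin n → ℝ)} (h : TSD S) : TSD (coborder S) := by
  rw [coborder_eq_union_closure_compl]
  exact h.union h.closure.compl

theorem IsNashMap.tsd {n m : ℕ} {U : Set (Fin n → ℝ)} {g : (Fin n → ℝ) → (Fin m → ℝ)}
    (h : IsNashMap U g) {κ : Type} (a : Fin n → κ) (b : Fin m → κ) :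
    TSD {z : κ → ℝ | (fun i => z (a i)) ∈ U ∧ ∀ j, g (fun i => z (a i)) j = z (b j)} :=
  (h.2.tsd.comap (Fin.addCases a b)).of_iff (by intro z; simp)

theorem IsNashFun.tsd {n : ℕ} {U : Set (Fin n → ℝ)} {g : (Fin n → ℝ) → ℝ}
    (h : IsNashFun U g) {κ : Type} (a : Fin n → κ) (b : κ) :
    TSD {z : κ → ℝ | (fun i => z (a i)) ∈ U ∧ g (fun i => z (a i)) = z b} :=
  (h.2.tsd.comap (Fin.addCases a (fun _ => b))).of_iff (by intro z; simp)

theorem ts_closed_mono {n : ℕ} {X U V : Set (Fin n → ℝ)} (hUV : U ⊆ V)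
    (h : IsClosed ((Subtype.val ⁻¹' X : Set ↥V))) : IsClosed ((Subtype.val ⁻¹' X : Set ↥U)) :=
  h.preimage (continuous_inclusion hUV)

theorem ts_nash_preimage {n m : ℕ} {U : Set (Fin n → ℝ)} {V : Set (Fin m → ℝ)}
    {g : (Fin n → ℝ) → (Fin m → ℝ)} (hg : IsNashMap U g) (hV : TSD V) :
    TSD (U ∩ g ⁻¹' V) := by
  have := TSD.exists_fin m (ι := Fin n) (fun x y => (x ∈ U ∧ ∀ j, g x j = y j) ∧ y ∈ V)
    (((hg.tsd (κ := Fin n ⊕ Fin m) Sum.inl Sum.inr).inter (hV.comap Sum.inr)).of_iff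
      (by intro z; rfl))
  refine this.of_iff (fun x => ?_)
  constructor
  · rintro ⟨h1, h2⟩
    exact ⟨g x, ⟨h1, fun _ => rfl⟩, h2⟩
  · rintro ⟨y, ⟨h1, h2⟩, h3⟩
    obtain rfl : g x = y := funext h2
    exact ⟨h1, h3⟩

theorem ts_nash_comp {n m : ℕ} {U : Set (Fin n → ℝ)} {V : Set (Fin m → ℝ)}
    {g : (Fin n → ℝ) → (Fin m → ℝ)} {h : (Fin m → ℝ) → ℝ} (hg : IsNashMap U g)
    (hh : IsNashFun V h) : IsNashFun (U ∩ g ⁻¹' V) (h ∘ g) := by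
  refine ⟨hh.1.comp (hg.1.mono Set.inter_subset_left) (fun x hx => hx.2), ?_⟩
  apply TSD.isSemialgebraic
  have := TSD.exists_fin m (ι := Fin (n + 1)) (fun p y =>
    ((fun i => p (Fin.castAdd 1 i)) ∈ U ∧ ∀ j, g (fun i => p (Fin.castAdd 1 i)) j = y j) ∧
      (y ∈ V ∧ h y = p (Fin.natAdd n 0)))
    (((hg.tsd (κ := Fin (n + 1) ⊕ Fin m) (fun i => Sum.inl (Fin.castAdd 1 i)) Sum.inr).inter
      (hh.tsd Sum.inr (Sum.inl (Fin.natAdd n 0)))).of_iff (by intro z; rfl))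
  refine this.of_iff (fun p => ?_)
  constructor
  · rintro ⟨⟨h1, h2⟩, h3⟩
    exact ⟨_, ⟨h1, fun _ => rfl⟩, h2, h3⟩
  · rintro ⟨y, ⟨h1, h2⟩, h3, h4⟩
    obtain rfl := funext h2
    exact ⟨⟨h1, h3⟩, h4⟩

theorem ts_coord {m : ℕ} (Y : Set (Fin m → ℝ)) (hYsa : IsSemialgebraic Y)
    (hYlc : IsLocallyClosed Y) (j : Fin m) : IsNQNFun Y (fun y => y j) := by
  have hU : TSD (coborder Y) := hYsa.tsd.coborder
  refine ⟨coborder Y, isLocallyClosed_iff_isOpen_coborder.1 hYlc, hU.isSemialgebraic,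
    subset_coborder, isClosed_preimage_val_coborder, fun y => y j, ⟨?_, ?_⟩, fun _ _ => rfl⟩
  · exact (contDiff_apply ℝ ℝ j).contDiffOn
  · apply TSD.isSemialgebraic
    let d : MvPolynomial (Fin (m + 1)) ℝ :=
      MvPolynomial.X (Fin.castAdd 1 j) - MvPolynomial.X (Fin.natAdd m 0)
    have h1 := ((TSD.pos d).union (TSD.pos (-d))).compl
    refine ((hU.comap (Fin.castAdd 1)).inter h1).of_iff (fun p => ?_)
    refine and_congr Iff.rfl ?_
    simp only [Set.mem_compl_iff, Set.mem_union, Set.mem_ofPred_eq, d, map_neg, map_sub,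
      MvPolynomial.eval_X, not_or, not_lt]
    constructor
    · intro h; constructor <;> linarith
    · rintro ⟨h1, h2⟩; linarith

/-- A continuous map `φ : X → Y` between locally closed semialgebraic sets is an NQN
morphism iff it pulls back NQN functions on `Y` to NQN functions on `X`. -/
theorem stmt_8 {n m : ℕ} (X : Set (Fin n → ℝ)) (Y : Set (Fin m → ℝ))
    (hXsa : IsSemialgebraic X) (hXlc : IsLocallyClosed X)
    (hYsa : IsSemialgebraic Y) (hYlc : IsLocallyClosed Y)
    (φ : (Fin n → ℝ) → (Fin m → ℝ))
    (hmap : Set.MapsTo φ X Y) (hcont : ContinuousOn φ X) :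
    IsNQNMap X φ ↔ ∀ f : (Fin m → ℝ) → ℝ, IsNQNFun Y f → IsNQNFun X (f ∘ φ) := by
  constructor
  · rintro ⟨U, hUo, hUsa, hXU, hXc, g, hg, hgφ⟩ f ⟨V, hVo, hVsa, hYV, hYc, h, hh, hhf⟩
    refine ⟨U ∩ g ⁻¹' V, hg.1.continuousOn.isOpen_inter_preimage hUo hVo,
      (ts_nash_preimage hg hVsa.tsd).isSemialgebraic, ?_, ts_closed_mono Set.inter_subset_left hXc,
      h ∘ g, ts_nash_comp hg hh, ?_⟩
    · intro x hx
      refine ⟨hXU hx, ?_⟩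
      rw [Set.mem_preimage, hgφ x hx]
      exact hYV (hmap hx)
    · intro x hx
      simp only [Function.comp]
      rw [hgφ x hx]
      exact hhf _ (hmap hx)
  · intro H
    have H' := fun j => H _ (ts_coord Y hYsa hYlc j)
    choose U hUo hUsa hXU hXc g hg hgφ using H'
    have hcb : TSD (coborder X) := hXsa.tsd.coborder
    have hW : TSD (coborder X ∩ {x | ∀ j, x ∈ U j}) :=
      hcb.inter (TSD.forallFin (fun j => (hUsa j).tsd))
    refine ⟨coborder X ∩ {x | ∀ j, x ∈ U j}, ?_, hW.isSemialgebraic, ?_,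
      ts_closed_mono Set.inter_subset_left isClosed_preimage_val_coborder,
      fun x j => g j x, ⟨?_, ?_⟩, ?_⟩
    · refine (isLocallyClosed_iff_isOpen_coborder.1 hXlc).inter ?_
      have : {x | ∀ j, x ∈ U j} = ⋂ j, U j := by ext x; simp
      rw [this]
      exact isOpen_iInter_of_finite hUo
    · exact fun x hx => ⟨subset_coborder hx, fun j => hXU j hx⟩
    · rw [contDiffOn_pi]
      exact fun j => (hg j).1.mono (fun x hx => hx.2 j)
    · apply TSD.isSemialgebraic
      refine ((hW.comap (Fin.castAdd m)).inter (TSD.forallFin (fun j =>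
        (hg j).tsd (Fin.castAdd m) (Fin.natAdd n j)))).of_iff (fun p => ?_)
      constructor
      · rintro ⟨h1, h2⟩
        exact ⟨h1, fun j => ⟨h1.2 j, h2 j⟩⟩
      · rintro ⟨h1, h2⟩
        exact ⟨h1, fun j => (h2 j).2⟩
    · intro x hx
      ext j
      exact hgφ j x hx
end
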